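/- Let C ⊂ ℙ² be a smooth plane cubic over a field k whose characteristic is relatively prime to 6, and let T_C ⊂ (ℙ²)∨ be the set of its nine inflection lines. If a plane sextic in (ℙ²)∨ is reduced, singular at every point of T_C, and has a cusp at at least one point of T_C, then it equals the dual curve C∨ of C; in particular all of its singular points are cusps. -/

import Mathlib

/-!
STATEMENT 3 (Pacini–Testa, Theorem `n23`): let `C ⊂ ℙ²` be a smooth plane cubic over a
field `k` whose characteristic is prime to 6, and `T_C ⊂ (ℙ²)∨` its set of inflection
lines.  If a plane sextic in `(ℙ²)∨` is reduced, singular at every point of `T_C` and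
has a cusp at at least one point of `T_C`, then it is the dual curve `C∨` of `C` (the
geometrically integral curve through the image of the Gauss map of `C`); in particular
all of its singular points at `T_C` are cusps.
-/

open MvPolynomial Polynomial

noncomputable section

namespace Infl

variable {K : Type*} [Field K]

def dotv (w p : Fin 3 → K) : K := ∑ i, w i * p i

def lineRestrict (F : MvPolynomial (Fin 3) K) (a b : Fin 3 → K) : Polynomial K :=
  MvPolynomial.aeval (fun i => Polynomial.C (a i) + Polynomial.C (b i) * Polynomial.X) F

def contactAt (F : MvPolynomial (Fin 3) K) (a b : Fin 3 → K) : ℕ :=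
  (lineRestrict F a b).rootMultiplicity 0

def IsSmoothCurve (F : MvPolynomial (Fin 3) K) (d : ℕ) : Prop :=
  F.IsHomogeneous d ∧ F ≠ 0 ∧
    ∀ p : Fin 3 → K, p ≠ 0 → eval p F = 0 → ∃ i, eval p (pderiv i F) ≠ 0

def IsInflLine (F : MvPolynomial (Fin 3) K) (w : Fin 3 → K) : Prop :=
  w ≠ 0 ∧ ∃ a b : Fin 3 → K, dotv w a = 0 ∧ dotv w b = 0 ∧
    LinearIndependent K ![a, b] ∧ lineRestrict F a b ≠ 0 ∧ 3 ≤ contactAt F a b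

def SingAt (F : MvPolynomial (Fin 3) K) (p : Fin 3 → K) : Prop :=
  eval p F = 0 ∧ ∀ i, eval p (pderiv i F) = 0

def hessMat (F : MvPolynomial (Fin 3) K) (p : Fin 3 → K) : Matrix (Fin 3) (Fin 3) K :=
  Matrix.of fun i j => eval p (pderiv i (pderiv j F))

def cubicForm (F : MvPolynomial (Fin 3) K) (p v : Fin 3 → K) : K :=
  ∑ i, ∑ j, ∑ l, eval p (pderiv i (pderiv j (pderiv l F))) * v i * v j * v l

def IsCuspAt (F : MvPolynomial (Fin 3) K) (p : Fin 3 → K) : Prop :=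
  SingAt F p ∧ (hessMat F p).rank = 1 ∧
    ∀ v, (hessMat F p).mulVec v = 0 → LinearIndependent K ![p, v] → cubicForm F p v ≠ 0

def gradVec (F : MvPolynomial (Fin 3) K) (p : Fin 3 → K) : Fin 3 → K :=
  fun i => eval p (pderiv i F)

def ContainsGaussImage (G F : MvPolynomial (Fin 3) K) : Prop :=
  ∀ p : Fin 3 → K, p ≠ 0 → eval p F = 0 → eval (gradVec F p) G = 0

variable {k : Type*} [Field k]

def bar (F : MvPolynomial (Fin 3) k) : MvPolynomial (Fin 3) (AlgebraicClosure k) :=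
  MvPolynomial.map (algebraMap k (AlgebraicClosure k)) F

section Aux

/-- linear substitution -/
def subst (M : Matrix (Fin 3) (Fin 3) K) :
    MvPolynomial (Fin 3) K →ₐ[K] MvPolynomial (Fin 3) K :=
  MvPolynomial.aeval (fun i => ∑ j, MvPolynomial.C (M i j) * MvPolynomial.X j)

theorem subst_X (M : Matrix (Fin 3) (Fin 3) K) (i : Fin 3) :
    subst M (MvPolynomial.X i) = ∑ j, MvPolynomial.C (M i j) * MvPolynomial.X j := by
  unfold subst; rw [MvPolynomial.aeval_X]

theorem subst_C (M : Matrix (Fin 3) (Fin 3) K) (a : K) :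
    subst M (MvPolynomial.C a) = MvPolynomial.C a := by
  unfold subst; rw [MvPolynomial.aeval_C]; rfl

theorem eval_subst (M : Matrix (Fin 3) (Fin 3) K) (F : MvPolynomial (Fin 3) K) (p : Fin 3 → K) :
    eval p (subst M F) = eval (M.mulVec p) F := by
  induction F using MvPolynomial.induction_on with
  | C a => simp
  | add p q hp hq => simp [hp, hq]
  | mul_X p n hp => simp [hp, subst_X, Matrix.mulVec, dotProduct]

theorem subst_subst (M N : Matrix (Fin 3) (Fin 3) K) (F : MvPolynomial (Fin 3) K) :
    subst M (subst N F) = subst (N * M) F := by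
  induction F using MvPolynomial.induction_on with
  | C a => simp
  | add p q hp hq => simp [hp, hq]
  | mul_X p n hp =>
    have hX : subst M (subst N (MvPolynomial.X n)) = subst (N * M) (MvPolynomial.X n) := by
      simp only [subst_X, subst_C, map_sum, map_mul, Matrix.mul_apply]
      simp only [Finset.mul_sum, Finset.sum_mul]
      rw [Finset.sum_comm]
      simp only [mul_assoc]
    rw [map_mul, map_mul, map_mul, hp, hX]

theorem subst_one (F : MvPolynomial (Fin 3) K) :
    subst 1 F = F := by
  unfold subst
  have : (fun i => ∑ j, MvPolynomial.C ((1 : Matrix (Fin 3) (Fin 3) K) i j) * MvPolynomial.X j)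
      = (MvPolynomial.X : Fin 3 → MvPolynomial (Fin 3) K) := by
    funext i
    simp [Matrix.one_apply, apply_ite]
  rw [this]; simp

theorem pderiv_subst (M : Matrix (Fin 3) (Fin 3) K) (F : MvPolynomial (Fin 3) K) (i : Fin 3) :
    pderiv i (subst M F) = ∑ j, MvPolynomial.C (M j i) * subst M (pderiv j F) := by
  induction F using MvPolynomial.induction_on with
  | C a => simp
  | add p q hp hq => simp [hp, hq, mul_add, Finset.sum_add_distrib]
  | mul_X p n hp =>
    simp only [map_mul, pderiv_mul, hp, map_add, mul_add, Finset.sum_add_distrib]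
    congr 1
    · rw [Finset.sum_mul]; simp only [mul_assoc]
    · simp [subst_X, pderiv_X, Pi.single_apply, apply_ite, mul_comm]

/-- substitution by an invertible matrix, as a ring equivalence -/
def substEquiv (M N : Matrix (Fin 3) (Fin 3) K) (h : M * N = 1) (h' : N * M = 1) :
    MvPolynomial (Fin 3) K ≃+* MvPolynomial (Fin 3) K where
  toFun := subst M
  invFun := subst N
  left_inv F := by rw [subst_subst, h, subst_one]
  right_inv F := by rw [subst_subst, h', subst_one]
  map_mul' := map_mul _
  map_add' := map_add _

theorem irreducible_subst (M N : Matrix (Fin 3) (Fin 3) K) (h : M * N = 1) (h' : N * M = 1)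
    {F : MvPolynomial (Fin 3) K} (hF : Irreducible F) : Irreducible (subst M F) :=
  (MulEquiv.irreducible_iff (substEquiv M N h h')).2 hF

theorem squarefree_subst (M N : Matrix (Fin 3) (Fin 3) K) (h : M * N = 1) (h' : N * M = 1)
    {F : MvPolynomial (Fin 3) K} (hF : Squarefree F) : Squarefree (subst M F) := by
  intro x hx
  have := hF (subst N x) (by
    have h1 := map_dvd (subst N) hx
    rwa [map_mul, subst_subst, h, subst_one] at h1)
  have h2 := this.map (subst M)
  rwa [subst_subst, h', subst_one] at h2

theorem homog_subst (M : Matrix (Fin 3) (Fin 3) K) {F : MvPolynomial (Fin 3) K} {n : ℕ}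
    (hF : F.IsHomogeneous n) : (subst M F).IsHomogeneous n := by
  have := hF.aeval (fun i => ∑ j, MvPolynomial.C (M i j) * MvPolynomial.X j) (n := 1) (by
    intro i
    apply MvPolynomial.IsHomogeneous.sum
    intro j _
    simpa using (MvPolynomial.isHomogeneous_C (Fin 3) (M i j)).mul (MvPolynomial.isHomogeneous_X K j))
  rw [one_mul] at this
  exact this

theorem gradVec_subst (M : Matrix (Fin 3) (Fin 3) K) (F : MvPolynomial (Fin 3) K) (p : Fin 3 → K) :
    gradVec (subst M F) p = M.transpose.mulVec (gradVec F (M.mulVec p)) := by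
  funext i
  simp [gradVec, pderiv_subst, eval_subst, Matrix.mulVec, dotProduct]

theorem hessMat_subst (M : Matrix (Fin 3) (Fin 3) K) (F : MvPolynomial (Fin 3) K) (p : Fin 3 → K) :
    hessMat (subst M F) p = M.transpose * hessMat F (M.mulVec p) * M := by
  ext i j
  simp only [hessMat, Matrix.of_apply, pderiv_subst, map_sum, pderiv_C_mul, map_mul, MvPolynomial.eval_C,
    eval_subst, Matrix.mul_apply, Matrix.transpose_apply, Finset.mul_sum, Finset.sum_mul]
  refine Finset.sum_congr rfl fun a _ => Finset.sum_congr rfl fun b _ => ?_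
  ring

theorem cubicForm_subst (M : Matrix (Fin 3) (Fin 3) K) (F : MvPolynomial (Fin 3) K)
    (p v : Fin 3 → K) :
    cubicForm (subst M F) p v = cubicForm F (M.mulVec p) (M.mulVec v) := by
  simp only [cubicForm, pderiv_subst, map_sum, pderiv_C_mul, map_mul, MvPolynomial.eval_C,
    eval_subst]
  have hv : ∀ i, M.mulVec v i = M i 0 * v 0 + M i 1 * v 1 + M i 2 * v 2 := by
    intro i; simp [Matrix.mulVec, dotProduct, Fin.sum_univ_three]
  simp only [hv]
  generalize M.mulVec p = q
  simp only [Fin.sum_univ_three]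
  ring

theorem singAt_subst (M : Matrix (Fin 3) (Fin 3) K) (F : MvPolynomial (Fin 3) K) (p : Fin 3 → K)
    (h : SingAt F (M.mulVec p)) : SingAt (subst M F) p := by
  refine ⟨by rw [eval_subst]; exact h.1, fun i => ?_⟩
  simp [pderiv_subst, eval_subst, h.2]

theorem mulVec_cancel {M N : Matrix (Fin 3) (Fin 3) K} (h : M * N = 1) (v : Fin 3 → K) :
    M.mulVec (N.mulVec v) = v := by
  rw [Matrix.mulVec_mulVec, h, Matrix.one_mulVec]

theorem linInd_mulVec {M N : Matrix (Fin 3) (Fin 3) K} (h : N * M = 1) {a b : Fin 3 → K}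
    (hab : LinearIndependent K ![a, b]) :
    LinearIndependent K ![M.mulVec a, M.mulVec b] := by
  rw [LinearIndependent.pair_iff] at hab ⊢
  intro s t hst
  apply hab
  have := congrArg N.mulVec hst
  rwa [Matrix.mulVec_add, Matrix.mulVec_smul, Matrix.mulVec_smul, mulVec_cancel h,
    mulVec_cancel h, Matrix.mulVec_zero] at this

theorem cuspAt_subst (M N : Matrix (Fin 3) (Fin 3) K) (h : M * N = 1) (h' : N * M = 1)
    (F : MvPolynomial (Fin 3) K) (p : Fin 3 → K)
    (hc : IsCuspAt F (M.mulVec p)) : IsCuspAt (subst M F) p := by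
  have hu : IsUnit M.det := by
    have : M.det * N.det = 1 := by rw [← Matrix.det_mul, h, Matrix.det_one]
    exact IsUnit.of_mul_eq_one _ this
  refine ⟨singAt_subst M F p hc.1, ?_, ?_⟩
  · rw [hessMat_subst, Matrix.rank_mul_eq_left_of_isUnit_det _ _ hu,
      Matrix.rank_mul_eq_right_of_isUnit_det _ _ (by rwa [Matrix.det_transpose])]
    exact hc.2.1
  · intro v hv hl
    rw [cubicForm_subst]
    apply hc.2.2 _ _ (linInd_mulVec h' hl)
    rw [hessMat_subst, ← Matrix.mulVec_mulVec, ← Matrix.mulVec_mulVec] at hv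
    have h3 : N.transpose * M.transpose = 1 := by
      rw [← Matrix.transpose_mul, h, Matrix.transpose_one]
    have := congrArg N.transpose.mulVec hv
    rwa [mulVec_cancel h3, Matrix.mulVec_zero] at this

theorem lineRestrict_subst (M : Matrix (Fin 3) (Fin 3) K) (F : MvPolynomial (Fin 3) K)
    (a b : Fin 3 → K) :
    lineRestrict (subst M F) a b = lineRestrict F (M.mulVec a) (M.mulVec b) := by
  unfold lineRestrict
  induction F using MvPolynomial.induction_on with
  | C a => simp
  | add p q hp hq => simp [hp, hq]
  | mul_X p n hp =>
    rw [map_mul, map_mul, hp, map_mul]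
    congr 1
    simp [subst_X, Matrix.mulVec, dotProduct, Fin.sum_univ_three]
    ring

theorem dotv_eq (w p : Fin 3 → K) : dotv w p = dotProduct w p := rfl

theorem inflLine_subst (M N : Matrix (Fin 3) (Fin 3) K) (h' : N * M = 1)
    (F : MvPolynomial (Fin 3) K) (w : Fin 3 → K) (c : K) (hc : c ≠ 0)
    (hw : IsInflLine (subst M F) w) :
    IsInflLine F (c • N.transpose.mulVec w) := by
  obtain ⟨hw0, a, b, ha, hb, hl, h1, h2⟩ := hw
  have h3 : M.transpose * N.transpose = 1 := by
      rw [← Matrix.transpose_mul, h', Matrix.transpose_one]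
  have key : ∀ a, dotv w a = 0 → dotv (c • N.transpose.mulVec w) (M.mulVec a) = 0 := by
    intro a ha
    rw [dotv_eq, smul_dotProduct, Matrix.dotProduct_mulVec, ← Matrix.mulVec_transpose,
      mulVec_cancel h3, ← dotv_eq, ha, smul_zero]
  refine ⟨?_, M.mulVec a, M.mulVec b, key a ha, key b hb, linInd_mulVec h' hl, ?_, ?_⟩
  · intro h0
    rcases smul_eq_zero.1 h0 with h0 | h0
    · exact hc h0
    · apply hw0
      have := congrArg M.transpose.mulVec h0
      rwa [mulVec_cancel h3, Matrix.mulVec_zero] at this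
  · rwa [← lineRestrict_subst]
  · rwa [contactAt, ← lineRestrict_subst]

theorem homog_expand {n : ℕ} {F : MvPolynomial (Fin 3) K} (hF : F.IsHomogeneous n) :
    ∃ c : ℕ → ℕ → ℕ → K, F = ∑ i ∈ Finset.range (n + 1), ∑ j ∈ Finset.range (n + 1 - i),
      MvPolynomial.C (c i j (n - i - j)) * MvPolynomial.X 0 ^ i * MvPolynomial.X 1 ^ j *
        MvPolynomial.X 2 ^ (n - i - j) := by
  let e : ℕ → ℕ → ℕ → (Fin 3 →₀ ℕ) := fun i j k =>
    Finsupp.single 0 i + Finsupp.single 1 j + Finsupp.single 2 k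
  have he : ∀ d : Fin 3 →₀ ℕ, d = e (d 0) (d 1) (d 2) := by
    intro d; ext a; fin_cases a <;> simp [e]
  refine ⟨fun i j k => F.coeff (e i j k), ?_⟩
  have hm : ∀ i j k, MvPolynomial.C (F.coeff (e i j k)) * MvPolynomial.X 0 ^ i *
      MvPolynomial.X 1 ^ j * MvPolynomial.X 2 ^ k = monomial (e i j k) (F.coeff (e i j k)) := by
    intro i j k
    rw [MvPolynomial.X_pow_eq_monomial, MvPolynomial.X_pow_eq_monomial,
      MvPolynomial.X_pow_eq_monomial, MvPolynomial.C_mul_monomial, MvPolynomial.monomial_mul,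
      MvPolynomial.monomial_mul]
    simp [e]
  simp only [hm]
  rw [Finset.sum_sigma' (Finset.range (n + 1)) (fun i => Finset.range (n + 1 - i))
    (fun i j => monomial (e i j (n - i - j)) (F.coeff (e i j (n - i - j))))]
  conv_lhs => rw [F.as_sum]
  refine Finset.sum_of_injOn (fun d => (⟨d 0, d 1⟩ : Σ _ : ℕ, ℕ)) ?_ ?_ ?_ ?_
  · intro d hd d' hd' h
    have h1 := hF (MvPolynomial.mem_support_iff.1 hd)
    have h2 := hF (MvPolynomial.mem_support_iff.1 hd')
    rw [Finsupp.weight_apply, Finsupp.sum_fintype _ _ (by simp), Fin.sum_univ_three] at h1 h2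
    simp at h1 h2 h
    rw [he d, he d', h.1, h.2]
    have : d 2 = d' 2 := by omega
    rw [this]
  · intro d hd
    have h1 := hF (MvPolynomial.mem_support_iff.1 hd)
    rw [Finsupp.weight_apply, Finsupp.sum_fintype _ _ (by simp), Fin.sum_univ_three] at h1
    simp at h1
    simp
    omega
  · rintro ⟨i, j⟩ hij hn
    rw [MvPolynomial.monomial_eq_zero]
    by_contra h0
    apply hn
    refine ⟨_, MvPolynomial.mem_support_iff.2 h0, ?_⟩
    simp [e]
  · intro d hd
    have h1 := hF (MvPolynomial.mem_support_iff.1 hd)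
    rw [Finsupp.weight_apply, Finsupp.sum_fintype _ _ (by simp), Fin.sum_univ_three] at h1
    simp at h1
    have h2 : d = e (d 0) (d 1) (n - d 0 - d 1) := by
      have : n - d 0 - d 1 = d 2 := by omega
      rw [this]; exact he d
    simp only [← h2]

/-- formal partial derivative of the sextic with coefficients `c` -/
def gx (c : ℕ → ℕ → ℕ → K) (x y z : K) : K :=
    c 1 0 5 * z^5 + c 1 1 4 * y * z^4 + c 1 2 3 * y^2 * z^3 + c 1 3 2 * y^3 * z^2 +
    c 1 4 1 * y^4 * z + c 1 5 0 * y^5 + 2 * c 2 0 4 * x * z^4 + 2 * c 2 1 3 * x * y * z^3 +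
    2 * c 2 2 2 * x * y^2 * z^2 + 2 * c 2 3 1 * x * y^3 * z + 2 * c 2 4 0 * x * y^4 +
    3 * c 3 0 3 * x^2 * z^3 + 3 * c 3 1 2 * x^2 * y * z^2 + 3 * c 3 2 1 * x^2 * y^2 * z +
    3 * c 3 3 0 * x^2 * y^3 + 4 * c 4 0 2 * x^3 * z^2 + 4 * c 4 1 1 * x^3 * y * z +
    4 * c 4 2 0 * x^3 * y^2 + 5 * c 5 0 1 * x^4 * z + 5 * c 5 1 0 * x^4 * y + 6 * c 6 0 0 * x^5

/-- formal partial derivative of the sextic with coefficients `c` -/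
def gy (c : ℕ → ℕ → ℕ → K) (x y z : K) : K :=
    c 0 1 5 * z^5 + 2 * c 0 2 4 * y * z^4 + 3 * c 0 3 3 * y^2 * z^3 + 4 * c 0 4 2 * y^3 * z^2 +
    5 * c 0 5 1 * y^4 * z + 6 * c 0 6 0 * y^5 + c 1 1 4 * x * z^4 + 2 * c 1 2 3 * x * y * z^3 +
    3 * c 1 3 2 * x * y^2 * z^2 + 4 * c 1 4 1 * x * y^3 * z + 5 * c 1 5 0 * x * y^4 +
    c 2 1 3 * x^2 * z^3 + 2 * c 2 2 2 * x^2 * y * z^2 + 3 * c 2 3 1 * x^2 * y^2 * z +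
    4 * c 2 4 0 * x^2 * y^3 + c 3 1 2 * x^3 * z^2 + 2 * c 3 2 1 * x^3 * y * z +
    3 * c 3 3 0 * x^3 * y^2 + c 4 1 1 * x^4 * z + 2 * c 4 2 0 * x^4 * y + c 5 1 0 * x^5

/-- formal partial derivative of the sextic with coefficients `c` -/
def gz (c : ℕ → ℕ → ℕ → K) (x y z : K) : K :=
    6 * c 0 0 6 * z^5 + 5 * c 0 1 5 * y * z^4 + 4 * c 0 2 4 * y^2 * z^3 +
    3 * c 0 3 3 * y^3 * z^2 + 2 * c 0 4 2 * y^4 * z + c 0 5 1 * y^5 + 5 * c 1 0 5 * x * z^4 +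
    4 * c 1 1 4 * x * y * z^3 + 3 * c 1 2 3 * x * y^2 * z^2 + 2 * c 1 3 2 * x * y^3 * z +
    c 1 4 1 * x * y^4 + 4 * c 2 0 4 * x^2 * z^3 + 3 * c 2 1 3 * x^2 * y * z^2 +
    2 * c 2 2 2 * x^2 * y^2 * z + c 2 3 1 * x^2 * y^3 + 3 * c 3 0 3 * x^3 * z^2 +
    2 * c 3 1 2 * x^3 * y * z + c 3 2 1 * x^3 * y^2 + 2 * c 4 0 2 * x^4 * z +
    c 4 1 1 * x^4 * y + c 5 0 1 * x^5

/-- the sextic with coefficients `c` -/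
def polyOf (c : ℕ → ℕ → ℕ → K) : MvPolynomial (Fin 3) K :=
  ∑ i ∈ Finset.range 7, ∑ j ∈ Finset.range (7 - i),
      MvPolynomial.C (c i j (6 - i - j)) * MvPolynomial.X 0 ^ i * MvPolynomial.X 1 ^ j *
        MvPolynomial.X 2 ^ (6 - i - j)

theorem eval_gx (c : ℕ → ℕ → ℕ → K) (x y z : K) :
    eval ![x, y, z] (pderiv 0 (polyOf c)) = gx c x y z := by
  simp [polyOf, Finset.sum_range_succ, gx, pderiv_X]
  ring

theorem eval_gy (c : ℕ → ℕ → ℕ → K) (x y z : K) :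
    eval ![x, y, z] (pderiv 1 (polyOf c)) = gy c x y z := by
  simp [polyOf, Finset.sum_range_succ, gy, pderiv_X]
  ring

theorem eval_gz (c : ℕ → ℕ → ℕ → K) (x y z : K) :
    eval ![x, y, z] (pderiv 2 (polyOf c)) = gz c x y z := by
  simp [polyOf, Finset.sum_range_succ, gz, pderiv_X]
  ring

/-- cyclic permutation of the coefficients -/
def cyc (c : ℕ → ℕ → ℕ → K) : ℕ → ℕ → ℕ → K := fun i j k => c j k i

/-- exchange of the last two variables -/
def swp (c : ℕ → ℕ → ℕ → K) : ℕ → ℕ → ℕ → K := fun i j k => c i k j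

/-- singular at three of the points -/
def HH (c : ℕ → ℕ → ℕ → K) (μ : K) : Prop :=
  ∀ ε : K, ε ^ 3 = 1 → gx c μ ε (ε ^ 2) = 0 ∧ gy c μ ε (ε ^ 2) = 0 ∧ gz c μ ε (ε ^ 2) = 0

/-- weight 0 part of the singularity conditions -/
def Wt0 (c : ℕ → ℕ → ℕ → K) (μ : K) : Prop :=
    (c 1 1 4 + c 1 4 1 + 2 * c 2 2 2 * μ + 3 * c 3 0 3 * μ^2 + 3 * c 3 3 0 * μ^2 +
    4 * c 4 1 1 * μ^3 + 6 * c 6 0 0 * μ^5 = 0) ∧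
    (3 * c 0 3 3 + 6 * c 0 6 0 + c 1 1 4 * μ + 4 * c 1 4 1 * μ + 2 * c 2 2 2 * μ^2 +
    3 * c 3 3 0 * μ^3 + c 4 1 1 * μ^4 = 0) ∧
    (6 * c 0 0 6 + 3 * c 0 3 3 + 4 * c 1 1 4 * μ + c 1 4 1 * μ + 2 * c 2 2 2 * μ^2 +
    3 * c 3 0 3 * μ^3 + c 4 1 1 * μ^4 = 0)

/-- weight 1 part of the singularity conditions -/
def Wt1 (c : ℕ → ℕ → ℕ → K) (μ : K) : Prop :=
    (c 1 0 5 + c 1 3 2 + 2 * c 2 1 3 * μ + 2 * c 2 4 0 * μ + 3 * c 3 2 1 * μ^2 +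
    4 * c 4 0 2 * μ^3 + 5 * c 5 1 0 * μ^4 = 0) ∧
    (2 * c 0 2 4 + 5 * c 0 5 1 + 3 * c 1 3 2 * μ + c 2 1 3 * μ^2 + 4 * c 2 4 0 * μ^2 +
    2 * c 3 2 1 * μ^3 + c 5 1 0 * μ^5 = 0) ∧
    (4 * c 0 2 4 + c 0 5 1 + 5 * c 1 0 5 * μ + 2 * c 1 3 2 * μ + 3 * c 2 1 3 * μ^2 +
    c 3 2 1 * μ^3 + 2 * c 4 0 2 * μ^4 = 0)

/-- weight 2 part of the singularity conditions -/
def Wt2 (c : ℕ → ℕ → ℕ → K) (μ : K) : Prop :=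
    (c 1 2 3 + c 1 5 0 + 2 * c 2 0 4 * μ + 2 * c 2 3 1 * μ + 3 * c 3 1 2 * μ^2 +
    4 * c 4 2 0 * μ^3 + 5 * c 5 0 1 * μ^4 = 0) ∧
    (c 0 1 5 + 4 * c 0 4 2 + 2 * c 1 2 3 * μ + 5 * c 1 5 0 * μ + 3 * c 2 3 1 * μ^2 +
    c 3 1 2 * μ^3 + 2 * c 4 2 0 * μ^4 = 0) ∧
    (5 * c 0 1 5 + 2 * c 0 4 2 + 3 * c 1 2 3 * μ + 4 * c 2 0 4 * μ^2 + c 2 3 1 * μ^2 +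
    2 * c 3 1 2 * μ^3 + c 5 0 1 * μ^5 = 0)

theorem dft {ω : K} (h3 : (3 : K) ≠ 0) (hω : ω ^ 2 + ω + 1 = 0) {a b c : K}
    (h : ∀ ε : K, ε ^ 3 = 1 → a + ε * b + ε ^ 2 * c = 0) : a = 0 ∧ b = 0 ∧ c = 0 := by
  have e1 := h 1 (by ring)
  have e2 := h ω (by linear_combination (ω - 1) * hω)
  have e3 := h (ω ^ 2) (by linear_combination (ω ^ 3 + 1) * (ω - 1) * hω)
  refine ⟨?_, ?_, ?_⟩
  · apply mul_left_cancel₀ h3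
    linear_combination e1 + e2 + e3 - b * hω - c * (ω ^ 2 - ω + 1) * hω
  · apply mul_left_cancel₀ h3
    linear_combination e1 + ω ^ 2 * e2 + ω * e3 - a * hω - b * 2 * (ω - 1) * hω -
      c * (ω ^ 3 - ω + 1) * hω
  · apply mul_left_cancel₀ h3
    linear_combination e1 + ω * e2 + ω ^ 2 * e3 - a * hω - c * (ω - 1) * (ω ^ 3 + 2) * hω - b * (ω ^ 2 - ω + 1) * hω

theorem weights {ω μ : K} (h3 : (3 : K) ≠ 0) (hω : ω ^ 2 + ω + 1 = 0) (c : ℕ → ℕ → ℕ → K)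
    (h : HH c μ) : Wt0 c μ ∧ Wt1 c μ ∧ Wt2 c μ := by
  have k0 := dft h3 hω (a := c 1 1 4 + c 1 4 1 + 2 * c 2 2 2 * μ + 3 * c 3 0 3 * μ^2 + 3 * c 3 3 0 * μ^2 +
    4 * c 4 1 1 * μ^3 + 6 * c 6 0 0 * μ^5)
    (b := c 1 0 5 + c 1 3 2 + 2 * c 2 1 3 * μ + 2 * c 2 4 0 * μ + 3 * c 3 2 1 * μ^2 +
    4 * c 4 0 2 * μ^3 + 5 * c 5 1 0 * μ^4)
    (c := c 1 2 3 + c 1 5 0 + 2 * c 2 0 4 * μ + 2 * c 2 3 1 * μ + 3 * c 3 1 2 * μ^2 +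
    4 * c 4 2 0 * μ^3 + 5 * c 5 0 1 * μ^4) (by
      intro ε hε
      have h1 := (h ε hε).1
      unfold gx at h1
      linear_combination h1 - (c 1 0 5 * (ε ^ 1 + ε ^ 4 + ε ^ 7) + c 1 1 4 * (ε ^ 0 + ε ^ 3 + ε ^ 6) +
    c 1 2 3 * (ε ^ 2 + ε ^ 5) + c 1 3 2 * (ε ^ 1 + ε ^ 4) + c 1 4 1 * (ε ^ 0 + ε ^ 3) +
    c 1 5 0 * (ε ^ 2) + 2 * c 2 0 4 * μ * (ε ^ 2 + ε ^ 5) + 2 * c 2 1 3 * μ * (ε ^ 1 + ε ^ 4) +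
    2 * c 2 2 2 * μ * (ε ^ 0 + ε ^ 3) + 2 * c 2 3 1 * μ * (ε ^ 2) + 2 * c 2 4 0 * μ * (ε ^ 1) +
    3 * c 3 0 3 * μ^2 * (ε ^ 0 + ε ^ 3) + 3 * c 3 1 2 * μ^2 * (ε ^ 2) +
    3 * c 3 2 1 * μ^2 * (ε ^ 1) + 3 * c 3 3 0 * μ^2 * (ε ^ 0) + 4 * c 4 0 2 * μ^3 * (ε ^ 1) +
    4 * c 4 1 1 * μ^3 * (ε ^ 0)) * hε)
  have k1 := dft h3 hω (a := 3 * c 0 3 3 + 6 * c 0 6 0 + c 1 1 4 * μ + 4 * c 1 4 1 * μ + 2 * c 2 2 2 * μ^2 +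
    3 * c 3 3 0 * μ^3 + c 4 1 1 * μ^4)
    (b := 2 * c 0 2 4 + 5 * c 0 5 1 + 3 * c 1 3 2 * μ + c 2 1 3 * μ^2 + 4 * c 2 4 0 * μ^2 +
    2 * c 3 2 1 * μ^3 + c 5 1 0 * μ^5)
    (c := c 0 1 5 + 4 * c 0 4 2 + 2 * c 1 2 3 * μ + 5 * c 1 5 0 * μ + 3 * c 2 3 1 * μ^2 +
    c 3 1 2 * μ^3 + 2 * c 4 2 0 * μ^4) (by
      intro ε hε
      have h1 := (h ε hε).2.1
      unfold gy at h1
      linear_combination ε * h1 - (c 0 1 5 * (ε ^ 2 + ε ^ 5 + ε ^ 8) + 2 * c 0 2 4 * (ε ^ 1 + ε ^ 4 + ε ^ 7) +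
    3 * c 0 3 3 * (ε ^ 0 + ε ^ 3 + ε ^ 6) + 4 * c 0 4 2 * (ε ^ 2 + ε ^ 5) +
    5 * c 0 5 1 * (ε ^ 1 + ε ^ 4) + 6 * c 0 6 0 * (ε ^ 0 + ε ^ 3) +
    c 1 1 4 * μ * (ε ^ 0 + ε ^ 3 + ε ^ 6) + 2 * c 1 2 3 * μ * (ε ^ 2 + ε ^ 5) +
    3 * c 1 3 2 * μ * (ε ^ 1 + ε ^ 4) + 4 * c 1 4 1 * μ * (ε ^ 0 + ε ^ 3) +
    5 * c 1 5 0 * μ * (ε ^ 2) + c 2 1 3 * μ^2 * (ε ^ 1 + ε ^ 4) +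
    2 * c 2 2 2 * μ^2 * (ε ^ 0 + ε ^ 3) + 3 * c 2 3 1 * μ^2 * (ε ^ 2) +
    4 * c 2 4 0 * μ^2 * (ε ^ 1) + c 3 1 2 * μ^3 * (ε ^ 2) + 2 * c 3 2 1 * μ^3 * (ε ^ 1) +
    3 * c 3 3 0 * μ^3 * (ε ^ 0) + c 4 1 1 * μ^4 * (ε ^ 0)) * hε)
  have k2 := dft h3 hω (a := 6 * c 0 0 6 + 3 * c 0 3 3 + 4 * c 1 1 4 * μ + c 1 4 1 * μ + 2 * c 2 2 2 * μ^2 +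
    3 * c 3 0 3 * μ^3 + c 4 1 1 * μ^4)
    (b := 4 * c 0 2 4 + c 0 5 1 + 5 * c 1 0 5 * μ + 2 * c 1 3 2 * μ + 3 * c 2 1 3 * μ^2 +
    c 3 2 1 * μ^3 + 2 * c 4 0 2 * μ^4)
    (c := 5 * c 0 1 5 + 2 * c 0 4 2 + 3 * c 1 2 3 * μ + 4 * c 2 0 4 * μ^2 + c 2 3 1 * μ^2 +
    2 * c 3 1 2 * μ^3 + c 5 0 1 * μ^5) (by
      intro ε hε
      have h1 := (h ε hε).2.2
      unfold gz at h1
      linear_combination ε ^ 2 * h1 - (6 * c 0 0 6 * (ε ^ 0 + ε ^ 3 + ε ^ 6 + ε ^ 9) + 5 * c 0 1 5 * (ε ^ 2 + ε ^ 5 + ε ^ 8) +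
    4 * c 0 2 4 * (ε ^ 1 + ε ^ 4 + ε ^ 7) + 3 * c 0 3 3 * (ε ^ 0 + ε ^ 3 + ε ^ 6) +
    2 * c 0 4 2 * (ε ^ 2 + ε ^ 5) + c 0 5 1 * (ε ^ 1 + ε ^ 4) +
    5 * c 1 0 5 * μ * (ε ^ 1 + ε ^ 4 + ε ^ 7) + 4 * c 1 1 4 * μ * (ε ^ 0 + ε ^ 3 + ε ^ 6) +
    3 * c 1 2 3 * μ * (ε ^ 2 + ε ^ 5) + 2 * c 1 3 2 * μ * (ε ^ 1 + ε ^ 4) +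
    c 1 4 1 * μ * (ε ^ 0 + ε ^ 3) + 4 * c 2 0 4 * μ^2 * (ε ^ 2 + ε ^ 5) +
    3 * c 2 1 3 * μ^2 * (ε ^ 1 + ε ^ 4) + 2 * c 2 2 2 * μ^2 * (ε ^ 0 + ε ^ 3) +
    c 2 3 1 * μ^2 * (ε ^ 2) + 3 * c 3 0 3 * μ^3 * (ε ^ 0 + ε ^ 3) +
    2 * c 3 1 2 * μ^3 * (ε ^ 2) + c 3 2 1 * μ^3 * (ε ^ 1) + 2 * c 4 0 2 * μ^4 * (ε ^ 1) +
    c 4 1 1 * μ^4 * (ε ^ 0)) * hε)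
  exact ⟨⟨k0.1, k1.1, k2.1⟩, ⟨k0.2.1, k1.2.1, k2.2.1⟩, ⟨k0.2.2, k1.2.2, k2.2.2⟩⟩

theorem weight_one_aux {μ : K} (h3 : (3 : K) ≠ 0) (h2 : (2 : K) ≠ 0) (hμ : μ ^ 3 ≠ 1)
    (c : ℕ → ℕ → ℕ → K) (h : Wt1 c μ) (h' : Wt1 (cyc (cyc c)) μ) (h'' : Wt1 (cyc c) μ) :
    c 5 1 0 = 0 ∧ c 4 0 2 = 0 ∧ c 3 2 1 = 0 := by
  obtain ⟨a1, a2, a3⟩ := h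
  obtain ⟨b1, b2, b3⟩ := h'
  obtain ⟨d1, d2, d3⟩ := h''
  simp only [cyc] at b1 b2 b3 d1 d2 d3
  have hD : (18 : K) * (μ ^ 3 - 1) ^ 3 ≠ 0 := by
    have : (18 : K) = 2 * 3 * 3 := by norm_num
    rw [this]
    exact mul_ne_zero (mul_ne_zero (mul_ne_zero h2 h3) h3) (pow_ne_zero _ (sub_ne_zero.2 hμ))
  refine ⟨?_, ?_, ?_⟩
  · apply mul_left_cancel₀ hD
    linear_combination 2 * (((-5)*μ^2+(2)*μ^5) * a1
      + ((-2)*μ+(-1)*μ^4) * a2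
      + ((1)*μ+(-4)*μ^4) * a3
      + ((4)*μ+(-1)*μ^4) * d1
      + ((-2)+(5)*μ^3) * d2
      + ((1)+(2)*μ^3) * d3)
  · apply mul_left_cancel₀ hD
    linear_combination 1 * (((-1)*μ^3+(1)*μ^6) * a1
      + ((5)*μ^2+(-5)*μ^5) * a2
      + ((-7)*μ^2+(7)*μ^5) * a3
      + ((7)*μ+(-1)*μ^4) * b1
      + ((1)+(5)*μ^3) * b2
      + ((-5)+(11)*μ^3) * b3
      + ((-8)*μ^2+(2)*μ^5) * d1
      + ((4)*μ+(-10)*μ^4) * d2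
      + ((-2)*μ+(-4)*μ^4) * d3)
  · apply mul_left_cancel₀ hD
    linear_combination 2 * (((14)*μ+(-1)*μ^4+(-1)*μ^7) * a1
      + ((2)+(5)*μ^3+(5)*μ^6) * a2
      + ((-1)+(11)*μ^3+(2)*μ^6) * a3
      + ((-3)*μ^2) * b1
      + ((-3)*μ) * b2
      + ((6)*μ+(-9)*μ^4) * b3
      + ((-9)+(-1)*μ^3+(1)*μ^6) * d1
      + ((-4)*μ^2+(-5)*μ^5) * d2
      + ((-7)*μ^2+(-2)*μ^5) * d3)

theorem weight_one {μ : K} (h3 : (3 : K) ≠ 0) (h2 : (2 : K) ≠ 0) (hμ : μ ^ 3 ≠ 1)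
    (c : ℕ → ℕ → ℕ → K) (h : Wt1 c μ) (h' : Wt1 (cyc (cyc c)) μ) (h'' : Wt1 (cyc c) μ) :
    (c 5 1 0 = 0 ∧ c 4 0 2 = 0 ∧ c 3 2 1 = 0) ∧ (c 1 0 5 = 0 ∧ c 0 2 4 = 0 ∧ c 2 1 3 = 0) ∧
    (c 0 5 1 = 0 ∧ c 2 4 0 = 0 ∧ c 1 3 2 = 0) := by
  refine ⟨weight_one_aux h3 h2 hμ c h h' h'', ?_, ?_⟩
  · exact weight_one_aux h3 h2 hμ (cyc c) h'' h h'
  · exact weight_one_aux h3 h2 hμ (cyc (cyc c)) h' h'' h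

theorem weight_zero_aux {μ : K} (h3 : (3 : K) ≠ 0) (h2 : (2 : K) ≠ 0) (hμ : μ ^ 3 ≠ 1)
    (c : ℕ → ℕ → ℕ → K) (h : Wt0 c μ) (h' : Wt0 (cyc (cyc c)) μ) (h'' : Wt0 (cyc c) μ) :
    c 6 0 0 = c 0 6 0 ∧ c 3 3 0 = c 0 3 3 ∧ c 4 1 1 = c 1 4 1 := by
  obtain ⟨a1, a2, a3⟩ := h
  obtain ⟨b1, b2, b3⟩ := h'
  obtain ⟨d1, d2, d3⟩ := h''
  simp only [cyc] at b1 b2 b3 d1 d2 d3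
  have hD : (6 : K) * (μ ^ 3 - 1) ^ 3 ≠ 0 := by
    have : (6 : K) = 2 * 3 := by norm_num
    rw [this]
    exact mul_ne_zero (mul_ne_zero h2 h3) (pow_ne_zero _ (sub_ne_zero.2 hμ))
  refine ⟨?_, ?_, ?_⟩
  · apply mul_left_cancel₀ hD
    linear_combination 1 * (((-3)*μ+(1)*μ^4) * a1
      + ((1)+(-3)*μ^3) * a2
      + ((-1)+(-1)*μ^3) * a3
      + ((3)*μ+(-1)*μ^4) * b1
      + ((1)+(1)*μ^3) * b2
      + ((-1)+(3)*μ^3) * b3)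
  · apply mul_left_cancel₀ hD
    linear_combination 2 * (((-1)*μ) * a1
      + ((1)+(-3)*μ^3) * a3
      + ((-1)+(3)*μ^3+(-1)*μ^6) * b2
      + ((1)+(-3)*μ^3+(1)*μ^6) * b3
      + ((1)*μ) * d1
      + ((-1)+(3)*μ^3) * d2)
  · apply mul_left_cancel₀ hD
    linear_combination 6 * (((1)) * a1
      + ((1)*μ^5) * a2
      + ((1)*μ^2) * a3
      + ((-1)) * b1
      + ((-1)*μ^2) * b2
      + ((-1)*μ^5) * b3)

theorem weight_zero {μ : K} (h3 : (3 : K) ≠ 0) (h2 : (2 : K) ≠ 0) (hμ : μ ^ 3 ≠ 1)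
    (c : ℕ → ℕ → ℕ → K) (h : Wt0 c μ) (h' : Wt0 (cyc (cyc c)) μ) (h'' : Wt0 (cyc c) μ) :
    (c 6 0 0 = c 0 6 0 ∧ c 3 3 0 = c 0 3 3 ∧ c 4 1 1 = c 1 4 1) ∧
    (c 0 0 6 = c 6 0 0 ∧ c 3 0 3 = c 3 3 0 ∧ c 1 1 4 = c 4 1 1) := by
  refine ⟨weight_zero_aux h3 h2 hμ c h h' h'', ?_⟩
  exact weight_zero_aux h3 h2 hμ (cyc c) h'' h h'

/-- a symmetric sextic -/
def symS (p q r t : K) : MvPolynomial (Fin 3) K :=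
  MvPolynomial.C p * (X 0 ^ 6 + X 1 ^ 6 + X 2 ^ 6) +
  MvPolynomial.C q * (X 0 ^ 3 * X 1 ^ 3 + X 1 ^ 3 * X 2 ^ 3 + X 0 ^ 3 * X 2 ^ 3) +
  MvPolynomial.C r * (X 0 * X 1 * X 2 * (X 0 ^ 3 + X 1 ^ 3 + X 2 ^ 3)) +
  MvPolynomial.C t * (X 0 ^ 2 * X 1 ^ 2 * X 2 ^ 2)

theorem swp_HH {μ : K} (c : ℕ → ℕ → ℕ → K) (h : HH c μ) : HH (swp c) μ := by
  intro ε hε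
  obtain ⟨h1, h2, h3⟩ := h (ε ^ 2) (by linear_combination (ε ^ 3 + 1) * hε)
  have h4 : (ε ^ 2) ^ 2 = ε := by linear_combination ε * hε
  rw [h4] at h1 h2 h3
  refine ⟨?_, ?_, ?_⟩
  · rw [← h1]; simp only [gx, swp]; ring
  · rw [← h3]; simp only [gy, gz, swp]; ring
  · rw [← h2]; simp only [gz, gy, swp]; ring

theorem sextic_normal {ω μ : K} (h3 : (3 : K) ≠ 0) (h2 : (2 : K) ≠ 0) (hμ : μ ^ 3 ≠ 1)
    (hω : ω ^ 2 + ω + 1 = 0) (G : MvPolynomial (Fin 3) K) (hG : G.IsHomogeneous 6)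
    (s0 : ∀ ε : K, ε ^ 3 = 1 → SingAt G ![μ, ε, ε ^ 2])
    (s1 : ∀ ε : K, ε ^ 3 = 1 → SingAt G ![ε ^ 2, μ, ε])
    (s2 : ∀ ε : K, ε ^ 3 = 1 → SingAt G ![ε, ε ^ 2, μ]) :
    ∃ p q r t : K, G = symS p q r t ∧
      6 * p * μ ^ 5 + 6 * q * μ ^ 2 + r * (4 * μ ^ 3 + 2) + 2 * t * μ = 0 ∧
      6 * p + 3 * q * (μ ^ 3 + 1) + r * (μ ^ 4 + 5 * μ) + 2 * t * μ ^ 2 = 0 := by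
  obtain ⟨c, hc⟩ := homog_expand hG
  have hc : G = polyOf c := hc
  have H0 : HH c μ := by
    intro ε hε
    have := (s0 ε hε).2
    rw [hc] at this
    exact ⟨by rw [← eval_gx]; exact this 0, by rw [← eval_gy]; exact this 1,
      by rw [← eval_gz]; exact this 2⟩
  have H2 : HH (cyc c) μ := by
    intro ε hε
    have := (s2 ε hε).2
    rw [hc] at this
    have t0 := this 0
    have t1 := this 1
    have t2 := this 2
    rw [eval_gx] at t0
    rw [eval_gy] at t1
    rw [eval_gz] at t2
    refine ⟨?_, ?_, ?_⟩
    · rw [← t2]; simp only [gx, gz, cyc]; ring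
    · rw [← t0]; simp only [gy, gx, cyc]; ring
    · rw [← t1]; simp only [gz, gy, cyc]; ring
  have H1 : HH (cyc (cyc c)) μ := by
    intro ε hε
    have := (s1 ε hε).2
    rw [hc] at this
    have t0 := this 0
    have t1 := this 1
    have t2 := this 2
    rw [eval_gx] at t0
    rw [eval_gy] at t1
    rw [eval_gz] at t2
    refine ⟨?_, ?_, ?_⟩
    · rw [← t1]; simp only [gx, gy, cyc]; ring
    · rw [← t2]; simp only [gy, gz, cyc]; ring
    · rw [← t0]; simp only [gz, gx, cyc]; ring
  have W0 := weights h3 hω _ H0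
  have W1 := weights h3 hω _ H1
  have W2 := weights h3 hω _ H2
  obtain ⟨⟨a1, a2, a3⟩, ⟨a4, a5, a6⟩, ⟨a7, a8, a9⟩⟩ :=
    weight_one h3 h2 hμ c W0.2.1 W1.2.1 W2.2.1
  obtain ⟨⟨b1, b2, b3⟩, ⟨b4, b5, b6⟩, ⟨b7, b8, b9⟩⟩ :=
    weight_one h3 h2 hμ (swp c) (weights h3 hω _ (swp_HH _ H0)).2.1
      (weights h3 hω _ (swp_HH _ H2)).2.1 (weights h3 hω _ (swp_HH _ H1)).2.1
  obtain ⟨⟨d1, d2, d3⟩, ⟨d4, d5, d6⟩⟩ := weight_zero h3 h2 hμ c W0.1 W1.1 W2.1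
  simp only [swp] at b1 b2 b3 b4 b5 b6 b7 b8 b9
  obtain ⟨e1, e2, -⟩ := W0.1
  refine ⟨c 6 0 0, c 3 3 0, c 4 1 1, c 2 2 2, ?_, ?_, ?_⟩
  · rw [hc]
    simp [polyOf, Finset.sum_range_succ, symS, a1, a2, a3, a4, a5, a6, a7, a8, a9, b1, b2, b3, b4,
      b5, b6, b7, b8, b9, ← d1, ← d2, ← d3, d4, d5, d6]
    ring
  · rw [← d3, d5, d6] at e1
    linear_combination e1
  · rw [← d1, ← d2, ← d3, d6] at e2
    linear_combination e2

theorem C_num : ((MvPolynomial.C (2 : K) : MvPolynomial (Fin 3) K) = 2) ∧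
    ((MvPolynomial.C (3 : K) : MvPolynomial (Fin 3) K) = 3) ∧
    ((MvPolynomial.C (4 : K) : MvPolynomial (Fin 3) K) = 4) ∧
    ((MvPolynomial.C (5 : K) : MvPolynomial (Fin 3) K) = 5) ∧
    ((MvPolynomial.C (6 : K) : MvPolynomial (Fin 3) K) = 6) :=
  ⟨map_ofNat MvPolynomial.C 2, map_ofNat MvPolynomial.C 3, map_ofNat MvPolynomial.C 4,
    map_ofNat MvPolynomial.C 5, map_ofNat MvPolynomial.C 6⟩

theorem pderiv_num (i : Fin 3) : pderiv i (2 : MvPolynomial (Fin 3) K) = 0 ∧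
    pderiv i (3 : MvPolynomial (Fin 3) K) = 0 ∧ pderiv i (4 : MvPolynomial (Fin 3) K) = 0 ∧
    pderiv i (5 : MvPolynomial (Fin 3) K) = 0 ∧ pderiv i (6 : MvPolynomial (Fin 3) K) = 0 := by
  obtain ⟨h2, h3, h4, h5, h6⟩ := C_num (K := K)
  rw [← h2, ← h3, ← h4, ← h5, ← h6]
  simp only [pderiv_C, and_self]

theorem pd_sym0 (p q r t : K) : pderiv 0 (symS p q r t) =
    MvPolynomial.C (6 * p) * X 0 ^ 5 + MvPolynomial.C (3 * q) * X 0 ^ 2 * (X 1 ^ 3 + X 2 ^ 3) +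
    MvPolynomial.C r * (X 1 * X 2) * (4 * X 0 ^ 3 + X 1 ^ 3 + X 2 ^ 3) +
    MvPolynomial.C (2 * t) * X 0 * X 1 ^ 2 * X 2 ^ 2 := by
  simp [symS, pderiv_X, C_num]; ring

theorem pd_sym1 (p q r t : K) : pderiv 1 (symS p q r t) =
    MvPolynomial.C (6 * p) * X 1 ^ 5 + MvPolynomial.C (3 * q) * X 1 ^ 2 * (X 0 ^ 3 + X 2 ^ 3) +
    MvPolynomial.C r * (X 0 * X 2) * (X 0 ^ 3 + 4 * X 1 ^ 3 + X 2 ^ 3) +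
    MvPolynomial.C (2 * t) * X 1 * X 0 ^ 2 * X 2 ^ 2 := by
  simp [symS, pderiv_X, C_num]; ring

theorem pd_sym2 (p q r t : K) : pderiv 2 (symS p q r t) =
    MvPolynomial.C (6 * p) * X 2 ^ 5 + MvPolynomial.C (3 * q) * X 2 ^ 2 * (X 0 ^ 3 + X 1 ^ 3) +
    MvPolynomial.C r * (X 0 * X 1) * (X 0 ^ 3 + X 1 ^ 3 + 4 * X 2 ^ 3) +
    MvPolynomial.C (2 * t) * X 2 * X 0 ^ 2 * X 1 ^ 2 := by
  simp [symS, pderiv_X, C_num]; ring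

/-- value of the Hessian at `(μ,1,1)` -/
theorem hess_sym (p q r t μ : K) : hessMat (symS p q r t) ![μ, 1, 1] =
    !![30 * p * μ ^ 4 + 12 * q * μ + 12 * r * μ ^ 2 + 2 * t,
        9 * q * μ ^ 2 + r * (4 * μ ^ 3 + 5) + 4 * t * μ,
        9 * q * μ ^ 2 + r * (4 * μ ^ 3 + 5) + 4 * t * μ;
      9 * q * μ ^ 2 + r * (4 * μ ^ 3 + 5) + 4 * t * μ,
        30 * p + 6 * q * (μ ^ 3 + 1) + 12 * r * μ + 2 * t * μ ^ 2,
        9 * q + r * (μ ^ 4 + 8 * μ) + 4 * t * μ ^ 2;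
      9 * q * μ ^ 2 + r * (4 * μ ^ 3 + 5) + 4 * t * μ,
        9 * q + r * (μ ^ 4 + 8 * μ) + 4 * t * μ ^ 2,
        30 * p + 6 * q * (μ ^ 3 + 1) + 12 * r * μ + 2 * t * μ ^ 2] := by
  ext i j
  fin_cases i <;> fin_cases j <;>
    simp [hessMat, pd_sym0, pd_sym1, pd_sym2, pderiv_X, pderiv_num] <;> ring

theorem cubic_sym (p q r t μ a b : K) : cubicForm (symS p q r t) ![μ, 1, 1] ![a, b, b] =
    (120 * p * μ ^ 3 + 12 * q + 24 * r * μ) * a ^ 3 +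
    3 * (36 * q * μ + 24 * r * μ ^ 2 + 8 * t) * a ^ 2 * b  +
    3 * (36 * q * μ ^ 2 + r * (8 * μ ^ 3 + 40) + 24 * t * μ) * a * b ^ 2 +
    (240 * p + q * (12 * μ ^ 3 + 120) + 120 * r * μ + 24 * t * μ ^ 2) * b ^ 3 := by
  simp [cubicForm, Fin.sum_univ_three, pd_sym0, pd_sym1, pd_sym2, pderiv_X, pderiv_num]
  ring

theorem cubic_sym_odd (p q r t μ : K) :
    cubicForm (symS p q r t) ![μ, 1, 1] ![0, 1, -1] = 0 := by
  simp [cubicForm, Fin.sum_univ_three, pd_sym0, pd_sym1, pd_sym2, pderiv_X, pderiv_num]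
  ring

/-- the dual of the Hesse cubic -/
def dualS (μ : K) : MvPolynomial (Fin 3) K :=
  symS 1 (4 * μ ^ 3 - 2) (-6 * μ ^ 2) (12 * μ - 3 * μ ^ 4)

theorem hess_dual (μ : K) : hessMat (dualS μ) ![μ, 1, 1] =
    !![0, 0, 0; 0, 18 * (μ ^ 3 - 1) ^ 2, -18 * (μ ^ 3 - 1) ^ 2;
      0, -18 * (μ ^ 3 - 1) ^ 2, 18 * (μ ^ 3 - 1) ^ 2] := by
  rw [dualS, hess_sym]
  ext i j
  fin_cases i <;> fin_cases j <;> simp <;> ring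

theorem cusp_dual (h3 : (3 : K) ≠ 0) (h2 : (2 : K) ≠ 0) {μ : K} (hμ : μ ^ 3 ≠ 1) :
    IsCuspAt (dualS μ) ![μ, 1, 1] := by
  have hμ' : μ ^ 3 - 1 ≠ 0 := sub_ne_zero.2 hμ
  have h18 : (18 : K) * (μ ^ 3 - 1) ^ 2 ≠ 0 := by
    have : (18 : K) = 2 * 3 * 3 := by norm_num
    rw [this]
    exact mul_ne_zero (mul_ne_zero (mul_ne_zero h2 h3) h3) (pow_ne_zero _ hμ')
  refine ⟨⟨?_, ?_⟩, ?_, ?_⟩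
  · simp [dualS, symS]; ring
  · intro i
    fin_cases i
    · simp [dualS, pd_sym0]; ring
    · simp [dualS, pd_sym1]; ring
    · simp [dualS, pd_sym2]; ring
  · rw [hess_dual]
    apply le_antisymm
    · have : !![0, 0, 0; 0, 18 * (μ ^ 3 - 1) ^ 2, -18 * (μ ^ 3 - 1) ^ 2;
        0, -18 * (μ ^ 3 - 1) ^ 2, 18 * (μ ^ 3 - 1) ^ 2] =
        Matrix.vecMulVec ![0, 18 * (μ ^ 3 - 1) ^ 2, -18 * (μ ^ 3 - 1) ^ 2] ![0, 1, -1] := by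
        ext i j
        fin_cases i <;> fin_cases j <;> simp [Matrix.vecMulVec]
      rw [this]
      exact Matrix.rank_vecMulVec_le _ _
    · rw [Nat.one_le_iff_ne_zero]
      intro h0
      rw [Matrix.rank, Submodule.finrank_eq_zero, LinearMap.range_eq_bot] at h0
      have := congrFun (LinearMap.congr_fun h0 ![0, 1, 0]) 1
      simp [Matrix.mulVec, dotProduct, Fin.sum_univ_three] at this
      rcases this with h | h
      · apply h18; rw [h]; simp
      · exact hμ' h
  · intro v hv hl
    rw [hess_dual] at hv
    have h1 := congrFun hv 1
    simp [Matrix.mulVec, dotProduct, Fin.sum_univ_three] at h1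
    have h12 : v 1 = v 2 := by
      apply mul_left_cancel₀ h18
      linear_combination h1
    have hv' : v = ![v 0, v 1, v 1] := by
      ext i; fin_cases i <;> simp [h12]
    rw [hv', dualS, cubic_sym]
    have h0 : v 0 - μ * v 1 ≠ 0 := by
      intro h0
      rw [LinearIndependent.pair_iff] at hl
      have := hl (- v 1) 1 (by
        ext i; fin_cases i
        · simp; linear_combination h0
        · simp
        · simp [h12])
      exact one_ne_zero this.2
    have h24 : (24 : K) ≠ 0 := by
      have : (24 : K) = 2 * 2 * 2 * 3 := by norm_num
      rw [this]
      exact mul_ne_zero (mul_ne_zero (mul_ne_zero h2 h2) h2) h3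
    have : (24 : K) * (μ ^ 3 - 1) * (v 0 - μ * v 1) ^ 3 ≠ 0 :=
      mul_ne_zero (mul_ne_zero h24 hμ') (pow_ne_zero _ h0)
    intro h
    apply this
    rw [← h]
    ring

theorem minor_zero {A : Matrix (Fin 3) (Fin 3) K} (h : A.rank = 1) (f g : Fin 2 → Fin 3) :
    A (f 0) (g 0) * A (f 1) (g 1) - A (f 0) (g 1) * A (f 1) (g 0) = 0 := by
  by_contra h0
  have hd : (A.submatrix f g).det ≠ 0 := by
    rw [Matrix.det_fin_two]; simpa using h0
  have h1 := Matrix.rank_of_isUnit (A.submatrix f g)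
    ((Matrix.isUnit_iff_isUnit_det _).2 (isUnit_iff_ne_zero.2 hd))
  have h2 := Matrix.rank_submatrix_le A f g
  rw [h1, h] at h2
  simp at h2

theorem cusp_forces_dual (h3 : (3 : K) ≠ 0) (h2 : (2 : K) ≠ 0) {μ : K} (hμ : μ ^ 3 ≠ 1)
    {p q r t : K} (hc : IsCuspAt (symS p q r t) ![μ, 1, 1])
    (e1 : 6 * p * μ ^ 5 + 6 * q * μ ^ 2 + r * (4 * μ ^ 3 + 2) + 2 * t * μ = 0)
    (e2 : 6 * p + 3 * q * (μ ^ 3 + 1) + r * (μ ^ 4 + 5 * μ) + 2 * t * μ ^ 2 = 0) :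
    symS p q r t = MvPolynomial.C p * dualS μ := by
  have hμ' : μ ^ 3 - 1 ≠ 0 := sub_ne_zero.2 hμ
  obtain ⟨-, hr, hk⟩ := hc
  have m1 := minor_zero hr ![0, 1] ![0, 1]
  have m2 := minor_zero hr ![0, 1] ![0, 2]
  have hk' := hk ![0, 1, -1]
  rw [hess_sym] at m1 m2 hk'
  simp at m1 m2
  have hprod : (30 * p * μ ^ 4 + 12 * q * μ + 12 * r * μ ^ 2 + 2 * t) *
      ((30 * p + 6 * q * (μ ^ 3 + 1) + 12 * r * μ + 2 * t * μ ^ 2) -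
        (9 * q + r * (μ ^ 4 + 8 * μ) + 4 * t * μ ^ 2)) = 0 := by
    linear_combination m1 - m2
  rcases mul_eq_zero.1 hprod with hB | hA
  · have hq : q = -2 * (μ ^ 3 + 1) * p - μ * r := by
      apply mul_left_cancel₀ (mul_ne_zero h3 hμ')
      linear_combination μ * e1 - e2
    have hr' : r = -6 * μ ^ 2 * p := by
      apply mul_left_cancel₀ (mul_ne_zero h2 hμ')
      rw [hq] at e1 hB
      linear_combination - e1 + μ * hB
    have ht : t = (12 * μ - 3 * μ ^ 4) * p := by
      apply mul_left_cancel₀ h2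
      rw [hq, hr'] at hB
      linear_combination hB
    have hq' : q = (4 * μ ^ 3 - 2) * p := by rw [hq, hr']; ring
    rw [hq', hr', ht]
    simp only [symS, dualS, map_mul, map_one]
    ring
  · exfalso
    refine hk' ?_ ?_ (cubic_sym_odd p q r t μ)
    · ext i
      fin_cases i
      · simp [Matrix.mulVec, dotProduct, Fin.sum_univ_three]
      · simp [Matrix.mulVec, dotProduct, Fin.sum_univ_three]
        linear_combination hA
      · simp [Matrix.mulVec, dotProduct, Fin.sum_univ_three]
        linear_combination - hA
    · rw [LinearIndependent.pair_iff]
      intro a b hab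
      have t1 := congrFun hab 1
      have t2 := congrFun hab 2
      simp at t1 t2
      constructor
      · apply mul_left_cancel₀ h2; linear_combination t1 + t2
      · apply mul_left_cancel₀ h2; linear_combination t1 - t2

theorem cusp_C_mul {G : MvPolynomial (Fin 3) K} {w : Fin 3 → K} {a : K} (ha : a ≠ 0)
    (h : IsCuspAt G w) : IsCuspAt (MvPolynomial.C a * G) w := by
  obtain ⟨⟨h0, h1⟩, hr, hk⟩ := h
  have hH : hessMat (MvPolynomial.C a * G) w = a • hessMat G w := by
    ext i j
    simp [hessMat]
  have hC : ∀ v, cubicForm (MvPolynomial.C a * G) w v = a * cubicForm G w v := by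
    intro v
    simp [cubicForm, Finset.mul_sum, mul_assoc]
  refine ⟨⟨by simp [h0], fun i => by simp [h1]⟩, ?_, ?_⟩
  · rw [hH]
    apply le_antisymm
    · have : a • hessMat G w = hessMat G w * (a • 1) := by simp
      rw [this]
      exact (Matrix.rank_mul_le_left _ _).trans hr.le
    · have : hessMat G w = (a • hessMat G w) * (a⁻¹ • 1) := by simp [smul_smul, ha]
      rw [← hr]
      conv_lhs => rw [this]
      exact Matrix.rank_mul_le_left _ _
  · intro v hv hl
    rw [hC]
    refine mul_ne_zero ha (hk v ?_ hl)
    rw [hH, Matrix.smul_mulVec] at hv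
    exact (smul_eq_zero.1 hv).resolve_left ha

theorem cusp_dual_of_symm (h3 : (3 : K) ≠ 0) (h2 : (2 : K) ≠ 0) {μ : K} (hμ : μ ^ 3 ≠ 1)
    (M N : Matrix (Fin 3) (Fin 3) K) (h : M * N = 1) (h' : N * M = 1) {a : K} (ha : a ≠ 0)
    (hs : MvPolynomial.C a * subst N (dualS μ) = dualS μ) :
    IsCuspAt (dualS μ) (M.mulVec ![μ, 1, 1]) := by
  rw [← hs]
  apply cusp_C_mul ha
  apply cuspAt_subst N M h' h
  rw [mulVec_cancel h']
  exact cusp_dual h3 h2 hμ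

theorem diag_dual {μ ι δ a : K} (hδ : δ ^ 3 = 1) (ha : a * ι ^ 6 = 1) :
    MvPolynomial.C a * subst (!![ι, 0, 0; 0, ι * δ, 0; 0, 0, ι * δ ^ 2]) (dualS μ) = dualS μ := by
  have hC : (MvPolynomial.C δ : MvPolynomial (Fin 3) K) ^ 3 = 1 := by rw [← map_pow, hδ, map_one]
  have hA : (MvPolynomial.C a : MvPolynomial (Fin 3) K) * MvPolynomial.C ι ^ 6 = 1 := by
    rw [← map_pow, ← map_mul, ha, map_one]
  have hN : (MvPolynomial.C a : MvPolynomial (Fin 3) K) *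
      subst (!![ι, 0, 0; 0, ι * δ, 0; 0, 0, ι * δ ^ 2]) (dualS μ) =
      (MvPolynomial.C a * MvPolynomial.C ι ^ 6) * dualS μ := by
    simp only [dualS, symS, map_add, map_mul, map_pow, subst_X, subst_C, Fin.sum_univ_three,
      Matrix.of_apply, Matrix.cons_val', Matrix.cons_val_zero, Matrix.cons_val_one,
      Matrix.cons_val, map_zero, zero_mul, add_zero, zero_add]
    generalize (MvPolynomial.C δ : MvPolynomial (Fin 3) K) = d at *
    generalize (MvPolynomial.C (4 * μ ^ 3 - 2) : MvPolynomial (Fin 3) K) = q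
    generalize (MvPolynomial.C (12 * μ - 3 * μ ^ 4) : MvPolynomial (Fin 3) K) = t
    simp only [← map_pow, ← map_mul]
    generalize (MvPolynomial.C (-6 * μ ^ 2) : MvPolynomial (Fin 3) K) = r
    simp only [map_pow, map_mul, map_one]
    linear_combination (MvPolynomial.C a * MvPolynomial.C ι ^ 6 *
      ((d ^ 3 + 1) * X 1 ^ 6 + (d ^ 9 + d ^ 6 + d ^ 3 + 1) * X 2 ^ 6 +
      q * (X 0 ^ 3 * X 1 ^ 3 + (d ^ 6 + d ^ 3 + 1) * X 1 ^ 3 * X 2 ^ 3 +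
        (d ^ 3 + 1) * X 0 ^ 3 * X 2 ^ 3) +
      r * X 0 * X 1 * X 2 * (X 0 ^ 3 + (d ^ 3 + 1) * X 1 ^ 3 + (d ^ 6 + d ^ 3 + 1) * X 2 ^ 3) +
      t * (d ^ 3 + 1) * X 0 ^ 2 * X 1 ^ 2 * X 2 ^ 2)) * hC
  rw [hN, hA, one_mul]

theorem perm_dual {μ : K} : subst (!![0, 1, 0; 0, 0, 1; 1, 0, 0]) (dualS μ) = dualS μ := by
  simp only [dualS, symS, map_add, map_mul, map_pow, subst_X, subst_C, Fin.sum_univ_three,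
      Matrix.of_apply, Matrix.cons_val', Matrix.cons_val_zero, Matrix.cons_val_one,
      Matrix.cons_val, map_zero, zero_mul, add_zero, zero_add, map_one, one_mul]
  ring

theorem cusp_dual0 (h3 : (3 : K) ≠ 0) (h2 : (2 : K) ≠ 0) {μ : K} (hμ : μ ^ 3 ≠ 1) {c ε : K}
    (hc : c ≠ 0) (hε : ε ^ 3 = 1) : IsCuspAt (dualS μ) ![c * μ, c * ε, c * ε ^ 2] := by
  have := cusp_dual_of_symm h3 h2 hμ !![c, 0, 0; 0, c * ε, 0; 0, 0, c * ε ^ 2]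
    !![c⁻¹, 0, 0; 0, c⁻¹ * ε ^ 2, 0; 0, 0, c⁻¹ * (ε ^ 2) ^ 2]
    (by
      ext i j
      fin_cases i <;> fin_cases j <;> simp [Matrix.mul_apply, Fin.sum_univ_three]
      · exact mul_inv_cancel₀ hc
      · field_simp; linear_combination hε
      · field_simp; linear_combination (ε ^ 3 + 1) * hε)
    (by
      ext i j
      fin_cases i <;> fin_cases j <;> simp [Matrix.mul_apply, Fin.sum_univ_three]
      · exact inv_mul_cancel₀ hc
      · field_simp; linear_combination hε
      · field_simp; linear_combination (ε ^ 3 + 1) * hε) (pow_ne_zero 6 hc)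
    (diag_dual (by linear_combination (ε ^ 3 + 1) * hε) (by field_simp))
  convert this using 1
  ext i
  fin_cases i <;> simp [Matrix.mulVec, dotProduct, Fin.sum_univ_three]

theorem cusp_dual_rot {μ : K} {a b c : K} (h : IsCuspAt (dualS μ) ![a, b, c]) :
    IsCuspAt (dualS μ) ![c, a, b] := by
  have := cuspAt_subst (!![0, 1, 0; 0, 0, 1; 1, 0, 0]) (!![0, 0, 1; 1, 0, 0; 0, 1, 0])
    (by ext i j; fin_cases i <;> fin_cases j <;> simp [Matrix.mul_apply, Fin.sum_univ_three])
    (by ext i j; fin_cases i <;> fin_cases j <;> simp [Matrix.mul_apply, Fin.sum_univ_three])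
    (dualS μ) ![c, a, b] (by
      convert h using 1
      ext i
      fin_cases i <;> simp [Matrix.mulVec, dotProduct, Fin.sum_univ_three])
  rwa [perm_dual] at this

/-- the Hesse cubic -/
def hesse (μ : K) : MvPolynomial (Fin 3) K :=
  X 0 ^ 3 + X 1 ^ 3 + X 2 ^ 3 - MvPolynomial.C (3 * μ) * (X 0 * X 1 * X 2)

theorem eval_hesse (μ : K) (p : Fin 3 → K) : eval p (hesse μ) =
    p 0 ^ 3 + p 1 ^ 3 + p 2 ^ 3 - 3 * μ * (p 0 * p 1 * p 2) := by
  simp [hesse]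

theorem grad_hesse (μ : K) (p : Fin 3 → K) : gradVec (hesse μ) p =
    ![3 * (p 0 ^ 2 - μ * (p 1 * p 2)), 3 * (p 1 ^ 2 - μ * (p 0 * p 2)),
      3 * (p 2 ^ 2 - μ * (p 0 * p 1))] := by
  ext i
  fin_cases i <;> simp [gradVec, hesse, pderiv_X] <;> ring

theorem grad_hesse_ne (h3 : (3 : K) ≠ 0) {μ : K} (hμ : μ ^ 3 ≠ 1) {p : Fin 3 → K} (hp : p ≠ 0) :
    gradVec (hesse μ) p ≠ 0 := by
  intro h
  rw [grad_hesse] at h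
  have e0 := congrFun h 0
  have e1 := congrFun h 1
  have e2 := congrFun h 2
  simp [h3] at e0 e1 e2
  have hm : (1 - μ ^ 3) * (p 0 * p 1 * p 2) ^ 2 = 0 := by
    linear_combination (p 1 ^ 2 * p 2 ^ 2) * e0 + (μ * (p 1 * p 2) * p 2 ^ 2) * e1 +
      (μ * (p 1 * p 2) * (μ * (p 0 * p 2))) * e2
  have h0 : p 0 * p 1 * p 2 = 0 := by
    rcases mul_eq_zero.1 hm with h | h
    · exact absurd (by linear_combination -h) hμ
    · exact pow_eq_zero_iff (two_ne_zero) |>.1 h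
  have c0 : p 0 ^ 3 = 0 := by linear_combination p 0 * e0 + μ * h0
  have c1 : p 1 ^ 3 = 0 := by linear_combination p 1 * e1 + μ * h0
  have c2 : p 2 ^ 3 = 0 := by linear_combination p 2 * e2 + μ * h0
  apply hp
  ext i
  fin_cases i
  · exact pow_eq_zero_iff (three_ne_zero) |>.1 c0
  · exact pow_eq_zero_iff (three_ne_zero) |>.1 c1
  · exact pow_eq_zero_iff (three_ne_zero) |>.1 c2

theorem perm_hesse {μ : K} : subst (!![0, 1, 0; 0, 0, 1; 1, 0, 0]) (hesse μ) = hesse μ := by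
  simp only [hesse, map_add, map_sub, map_mul, map_pow, subst_X, subst_C, Fin.sum_univ_three,
      Matrix.of_apply, Matrix.cons_val', Matrix.cons_val_zero, Matrix.cons_val_one,
      Matrix.cons_val, map_zero, zero_mul, add_zero, zero_add, map_one, one_mul]
  ring

theorem lineRestrict_hesse (μ : K) (a b : Fin 3 → K) : lineRestrict (hesse μ) a b =
    Polynomial.C (a 0 ^ 3 + a 1 ^ 3 + a 2 ^ 3 - 3 * μ * (a 0 * a 1 * a 2)) +
    Polynomial.C (3 * (a 0 ^ 2 - μ * (a 1 * a 2)) * b 0 + 3 * (a 1 ^ 2 - μ * (a 0 * a 2)) * b 1 +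
      3 * (a 2 ^ 2 - μ * (a 0 * a 1)) * b 2) * Polynomial.X +
    Polynomial.C (3 * (a 0 * b 0 ^ 2 + a 1 * b 1 ^ 2 + a 2 * b 2 ^ 2 -
      μ * (a 0 * b 1 * b 2 + a 1 * b 0 * b 2 + a 2 * b 0 * b 1))) * Polynomial.X ^ 2 +
    Polynomial.C (b 0 ^ 3 + b 1 ^ 3 + b 2 ^ 3 - 3 * μ * (b 0 * b 1 * b 2)) * Polynomial.X ^ 3 := by
  have h3 : (Polynomial.C (3 : K)) = 3 := map_ofNat Polynomial.C 3
  simp [lineRestrict, hesse, h3]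
  ring

theorem infl_hesse0 {μ : K} (hμ : μ ^ 3 ≠ 1) {ε : K} (hε : ε ^ 3 = 1) :
    IsInflLine (hesse μ) ![μ, ε, ε ^ 2] := by
  have hε0 : ε ≠ 0 := by rintro rfl; simp at hε
  have hl : lineRestrict (hesse μ) ![0, 1, -ε ^ 2] ![1, -μ * ε ^ 2, 0] =
      Polynomial.C (1 - μ ^ 3) * Polynomial.X ^ 3 := by
    rw [lineRestrict_hesse]
    have e0 : (0 : K) ^ 3 + 1 ^ 3 + (-ε ^ 2) ^ 3 - 3 * μ * (0 * 1 * (-ε ^ 2)) = 0 := by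
      linear_combination (-ε ^ 3 - 1) * hε
    have e3 : (1 : K) ^ 3 + (-μ * ε ^ 2) ^ 3 + 0 ^ 3 - 3 * μ * (1 * (-μ * ε ^ 2) * 0) =
        1 - μ ^ 3 := by
      linear_combination (-μ ^ 3 * (ε ^ 3 + 1)) * hε
    simp only [Matrix.cons_val_zero, Matrix.cons_val_one, Matrix.cons_val]
    rw [e0, e3]
    ring_nf
    simp
  have hne : (1 - μ ^ 3 : K) ≠ 0 := sub_ne_zero.2 (Ne.symm hμ)
  have hnp : Polynomial.C (1 - μ ^ 3) * Polynomial.X ^ 3 ≠ 0 :=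
    mul_ne_zero (Polynomial.C_ne_zero.2 hne) (pow_ne_zero _ Polynomial.X_ne_zero)
  refine ⟨?_, ![0, 1, -ε ^ 2], ![1, -μ * ε ^ 2, 0], ?_, ?_, ?_, ?_, ?_⟩
  · intro h; exact hε0 (by simpa using congrFun h 1)
  · simp [dotv, Fin.sum_univ_three]; linear_combination (-ε) * hε
  · simp [dotv, Fin.sum_univ_three]; linear_combination (-μ) * hε
  · rw [LinearIndependent.pair_iff]
    intro s t h
    have h0 := congrFun h 0
    have h1 := congrFun h 1
    simp at h0 h1
    subst h0
    simpa using h1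
  · rw [hl]; exact hnp
  · rw [contactAt, Polynomial.le_rootMultiplicity_iff (by rw [hl]; exact hnp), hl]
    simp

theorem infl_hesse_rot {μ a b c : K} (h : IsInflLine (hesse μ) ![a, b, c]) :
    IsInflLine (hesse μ) ![c, a, b] := by
  have := inflLine_subst (!![0, 1, 0; 0, 0, 1; 1, 0, 0]) (!![0, 0, 1; 1, 0, 0; 0, 1, 0])
    (by ext i j; fin_cases i <;> fin_cases j <;> simp [Matrix.mul_apply, Fin.sum_univ_three])
    (hesse μ) ![b, c, a] 1 one_ne_zero
  rw [perm_hesse] at this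
  have key : ∀ x y z : K, IsInflLine (hesse μ) ![x, y, z] → IsInflLine (hesse μ) ![y, z, x] := by
    intro x y z hx
    have := inflLine_subst (!![0, 1, 0; 0, 0, 1; 1, 0, 0]) (!![0, 0, 1; 1, 0, 0; 0, 1, 0])
      (by ext i j; fin_cases i <;> fin_cases j <;> simp [Matrix.mul_apply, Fin.sum_univ_three])
      (hesse μ) ![x, y, z] 1 one_ne_zero (by rwa [perm_hesse])
    convert this using 1
    ext i
    fin_cases i <;> simp [Matrix.mulVec, dotProduct, Fin.sum_univ_three]
  exact key _ _ _ (key _ _ _ h)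

theorem orth2 {a b v w : Fin 3 → K} (hl : LinearIndependent K ![a, b]) (hw : w ≠ 0)
    (wa : dotv w a = 0) (wb : dotv w b = 0) (va : dotv v a = 0) (vb : dotv v b = 0) :
    ∃ l : K, v = l • w := by
  have hn := crossProduct_ne_zero_iff_linearIndependent.2 hl
  set n := crossProduct a b with hndef
  have n0 : n 0 = a 1 * b 2 - a 2 * b 1 := by simp [hndef, cross_apply]
  have n1 : n 1 = a 2 * b 0 - a 0 * b 2 := by simp [hndef, cross_apply]
  have n2 : n 2 = a 0 * b 1 - a 1 * b 0 := by simp [hndef, cross_apply]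
  have key : ∀ u : Fin 3 → K, dotv u a = 0 → dotv u b = 0 → ∃ l : K, u = l • n := by
    intro u ua ub
    simp only [dotv, Fin.sum_univ_three] at ua ub
    have k01 : u 0 * n 1 = u 1 * n 0 := by rw [n0, n1]; linear_combination b 2 * (-ua) + a 2 * ub
    have k02 : u 0 * n 2 = u 2 * n 0 := by rw [n0, n2]; linear_combination b 1 * ua - a 1 * ub
    have k12 : u 1 * n 2 = u 2 * n 1 := by rw [n1, n2]; linear_combination b 0 * (-ua) + a 0 * ub
    have : ∃ i, n i ≠ 0 := by
      by_contra hcon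
      push Not at hcon
      exact hn (funext hcon)
    obtain ⟨i, hi⟩ := this
    refine ⟨u i / n i, ?_⟩
    ext j
    simp only [Pi.smul_apply, smul_eq_mul]
    rw [div_mul_eq_mul_div, eq_div_iff hi]
    fin_cases i <;> fin_cases j <;> simp [k01, k02, k12]
  obtain ⟨l, hl⟩ := key v va vb
  obtain ⟨m, hm⟩ := key w wa wb
  have hm0 : m ≠ 0 := by rintro rfl; exact hw (by simp [hm])
  exact ⟨l / m, by rw [hl, hm, smul_smul, div_mul_cancel₀ _ hm0]⟩

theorem cusp_at_infl (h3 : (3 : K) ≠ 0) (h2 : (2 : K) ≠ 0) {μ : K} (hμ : μ ^ 3 ≠ 1)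
    {w : Fin 3 → K} (hw : IsInflLine (hesse μ) w) : IsCuspAt (dualS μ) w := by
  obtain ⟨hw0, a, b, wa, wb, hl, hne, hc⟩ := hw
  rw [contactAt, Polynomial.le_rootMultiplicity_iff hne] at hc
  simp only [map_zero, sub_zero] at hc
  rw [Polynomial.X_pow_dvd_iff] at hc
  have q0 := hc 0 (by norm_num)
  have q1 := hc 1 (by norm_num)
  have q2 := hc 2 (by norm_num)
  rw [lineRestrict_hesse] at q0 q1 q2
  simp only [Polynomial.coeff_add, Polynomial.coeff_C_mul, Polynomial.coeff_X_pow,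
    Polynomial.coeff_X, Polynomial.coeff_C] at q0 q1 q2
  norm_num [h3] at q0 q1 q2
  have ha : a ≠ 0 := hl.ne_zero 0
  let H : Matrix (Fin 3) (Fin 3) K := !![2 * a 0, -μ * a 2, -μ * a 1; -μ * a 2, 2 * a 1, -μ * a 0;
    -μ * a 1, -μ * a 0, 2 * a 2]
  have hdet : H.det = 0 := by
    obtain ⟨l, hla⟩ := orth2 (v := H.mulVec a) hl hw0 wa wb
      (by simp [dotv, H, Matrix.mulVec, dotProduct, Fin.sum_univ_three]; linear_combination 2 * q0)
      (by
        apply mul_left_cancel₀ h3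
        simp only [dotv, H, Matrix.mulVec, dotProduct, Fin.sum_univ_three, Matrix.of_apply,
          Matrix.cons_val', Matrix.cons_val_zero, Matrix.cons_val_one, Matrix.cons_val]
        linear_combination 2 * q1)
    obtain ⟨m, hmb⟩ := orth2 (v := H.mulVec b) hl hw0 wa wb
      (by
        apply mul_left_cancel₀ h3
        simp only [dotv, H, Matrix.mulVec, dotProduct, Fin.sum_univ_three, Matrix.of_apply,
          Matrix.cons_val', Matrix.cons_val_zero, Matrix.cons_val_one, Matrix.cons_val]
        linear_combination 2 * q1)
      (by simp [dotv, H, Matrix.mulVec, dotProduct, Fin.sum_univ_three]; linear_combination 2 * q2)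
    by_contra hd
    have inj := Matrix.eq_zero_of_mulVec_eq_zero hd (v := m • a - l • b) (by
      rw [Matrix.mulVec_sub, Matrix.mulVec_smul, Matrix.mulVec_smul, hla, hmb, smul_smul,
        smul_smul, mul_comm, sub_self])
    rw [LinearIndependent.pair_iff] at hl
    have hlm := hl m (-l) (by rw [neg_smul, ← sub_eq_add_neg]; exact inj)
    have : l = 0 := by simpa using hlm.2
    subst this
    exact ha (Matrix.eq_zero_of_mulVec_eq_zero hd (by rw [hla, zero_smul]))
  have hxyz : a 0 * a 1 * a 2 = 0 := by
    have h8 : (2 : K) ^ 3 * (1 - μ ^ 3) ≠ 0 :=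
      mul_ne_zero (pow_ne_zero _ h2) (sub_ne_zero.2 (Ne.symm hμ))
    apply mul_left_cancel₀ h8
    rw [Matrix.det_fin_three] at hdet
    simp [H] at hdet
    linear_combination hdet + 2 * μ ^ 2 * q0
  have hg := grad_hesse_ne h3 hμ ha
  obtain ⟨c, hcw⟩ := orth2 (v := w) (w := gradVec (hesse μ) a) hl hg
    (by rw [grad_hesse]; simp [dotv, Fin.sum_univ_three]; linear_combination 3 * q0)
    (by rw [grad_hesse]; simp [dotv, Fin.sum_univ_three]; linear_combination q1) wa wb
  have hc0 : c ≠ 0 := by rintro rfl; exact hw0 (by simp [hcw])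
  rw [grad_hesse] at hcw
  -- the flex on the side opposite to one vertex
  have aux : ∀ y z : K, y ^ 3 + z ^ 3 = 0 → ¬ (y = 0 ∧ z = 0) → ∃ d e : K, d ≠ 0 ∧ e ^ 3 = 1 ∧
      d * μ = c * (3 * (-(μ * (y * z)))) ∧ d * e = c * (3 * y ^ 2) ∧
      d * e ^ 2 = c * (3 * z ^ 2) := by
    intro y z hyz hn
    have hy : y ≠ 0 := by
      rintro rfl
      exact hn ⟨rfl, pow_eq_zero_iff (three_ne_zero) |>.1 (by linear_combination hyz)⟩
    have hz : z ≠ 0 := by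
      rintro rfl
      exact hn ⟨pow_eq_zero_iff (three_ne_zero) |>.1 (by linear_combination hyz), rfl⟩
    refine ⟨c * 3 * (-(y * z)), -y / z, ?_, ?_, by ring, ?_, ?_⟩
    · exact mul_ne_zero (mul_ne_zero hc0 h3) (neg_ne_zero.2 (mul_ne_zero hy hz))
    · field_simp; linear_combination -hyz
    · field_simp
    · field_simp; linear_combination -hyz
  have hsum : a 0 = 0 ∨ a 1 = 0 ∨ a 2 = 0 := by
    rcases mul_eq_zero.1 hxyz with h | h
    · rcases mul_eq_zero.1 h with h | h
      · exact Or.inl h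
      · exact Or.inr (Or.inl h)
    · exact Or.inr (Or.inr h)
  rcases hsum with h | h | h
  · obtain ⟨d, e, hd, he, k0, k1, k2⟩ := aux (a 1) (a 2) (by rw [h] at q0; linear_combination q0)
      (by rintro ⟨u, v⟩; apply ha; ext i; fin_cases i <;> simp [h, u, v])
    have : w = ![d * μ, d * e, d * e ^ 2] := by
      rw [hcw, k0, k1, k2]; ext i; fin_cases i <;> simp [h]
    rw [this]
    exact cusp_dual0 h3 h2 hμ hd he
  · obtain ⟨d, e, hd, he, k0, k1, k2⟩ := aux (a 2) (a 0) (by rw [h] at q0; linear_combination q0)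
      (by rintro ⟨u, v⟩; apply ha; ext i; fin_cases i <;> simp [h, u, v])
    have : w = ![d * e ^ 2, d * μ, d * e] := by
      rw [hcw, k0, k1, k2]; ext i; fin_cases i <;> simp [h, mul_comm]
    rw [this]
    exact cusp_dual_rot (cusp_dual0 h3 h2 hμ hd he)
  · obtain ⟨d, e, hd, he, k0, k1, k2⟩ := aux (a 0) (a 1) (by rw [h] at q0; linear_combination q0)
      (by rintro ⟨u, v⟩; apply ha; ext i; fin_cases i <;> simp [h, u, v])
    have : w = ![d * e, d * e ^ 2, d * μ] := by
      rw [hcw, k0, k1, k2]; ext i; fin_cases i <;> simp [h]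
    rw [this]
    exact cusp_dual_rot (cusp_dual_rot (cusp_dual0 h3 h2 hμ hd he))

theorem eval_dual (μ : K) (w : Fin 3 → K) : eval w (dualS μ) =
    w 0 ^ 6 + w 1 ^ 6 + w 2 ^ 6 +
    (4 * μ ^ 3 - 2) * (w 0 ^ 3 * w 1 ^ 3 + w 1 ^ 3 * w 2 ^ 3 + w 0 ^ 3 * w 2 ^ 3) -
    6 * μ ^ 2 * (w 0 * w 1 * w 2 * (w 0 ^ 3 + w 1 ^ 3 + w 2 ^ 3)) +
    (12 * μ - 3 * μ ^ 4) * (w 0 ^ 2 * w 1 ^ 2 * w 2 ^ 2) := by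
  simp [dualS, symS]
  ring

theorem dual_id (x y z m : K) :
    (x ^ 2 - m * (y * z)) ^ 6 + (y ^ 2 - m * (x * z)) ^ 6 + (z ^ 2 - m * (x * y)) ^ 6 +
    (4 * m ^ 3 - 2) * ((x ^ 2 - m * (y * z)) ^ 3 * (y ^ 2 - m * (x * z)) ^ 3 +
      (y ^ 2 - m * (x * z)) ^ 3 * (z ^ 2 - m * (x * y)) ^ 3 +
      (x ^ 2 - m * (y * z)) ^ 3 * (z ^ 2 - m * (x * y)) ^ 3) -
    6 * m ^ 2 * ((x ^ 2 - m * (y * z)) * (y ^ 2 - m * (x * z)) * (z ^ 2 - m * (x * y)) *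
      ((x ^ 2 - m * (y * z)) ^ 3 + (y ^ 2 - m * (x * z)) ^ 3 + (z ^ 2 - m * (x * y)) ^ 3)) +
    (12 * m - 3 * m ^ 4) *
      ((x ^ 2 - m * (y * z)) ^ 2 * (y ^ 2 - m * (x * z)) ^ 2 * (z ^ 2 - m * (x * y)) ^ 2) =
    (x ^ 3 + y ^ 3 + z ^ 3 - 3 * m * (x * y * z)) *
    (x ^ 9 + y ^ 9 + z ^ 9 - (6 * m ^ 4 + 3 * m) * (x * y * z) * (x ^ 6 + y ^ 6 + z ^ 6) +
      (-4 * m ^ 6 + 8 * m ^ 3 - 1) * (x ^ 6 * y ^ 3 + x ^ 6 * z ^ 3 + x ^ 3 * y ^ 6 +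
        x ^ 3 * z ^ 6 + y ^ 6 * z ^ 3 + y ^ 3 * z ^ 6) +
      (-3 * m ^ 8 + 42 * m ^ 5 - 12 * m ^ 2) * (x ^ 2 * y ^ 2 * z ^ 2) *
        (x ^ 3 + y ^ 3 + z ^ 3) +
      (12 * m ^ 7 - 36 * m ^ 4 + 6 * m) * (x * y * z) *
        (x ^ 3 * y ^ 3 + x ^ 3 * z ^ 3 + y ^ 3 * z ^ 3) +
      (m ^ 9 - 60 * m ^ 6 + 36 * m ^ 3 + 2) * (x ^ 3 * y ^ 3 * z ^ 3)) := by
  ring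

theorem dual_gauss {μ : K} {p : Fin 3 → K} (hp : eval p (hesse μ) = 0) :
    eval (gradVec (hesse μ) p) (dualS μ) = 0 := by
  rw [eval_hesse] at hp
  have h := dual_id (p 0) (p 1) (p 2) μ
  rw [hp, zero_mul] at h
  rw [eval_dual, grad_hesse]
  simp only [Matrix.cons_val_zero, Matrix.cons_val_one, Matrix.cons_val]
  generalize p 0 ^ 2 - μ * (p 1 * p 2) = u at *
  generalize p 1 ^ 2 - μ * (p 0 * p 2) = v at *
  generalize p 2 ^ 2 - μ * (p 0 * p 1) = w at *
  linear_combination 729 * h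

/-- a singular binary cubic has a double root -/
theorem double_root (h2 : (2 : K) ≠ 0) (h3 : (3 : K) ≠ 0) (a b c d : K)
    (hd : (b * c - 9 * a * d) ^ 2 = 4 * (b ^ 2 - 3 * a * c) * (c ^ 2 - 3 * b * d)) :
    ∃ x y : K, ¬ (x = 0 ∧ y = 0) ∧ 3 * a * x ^ 2 + 2 * b * x * y + c * y ^ 2 = 0 ∧
      b * x ^ 2 + 2 * c * x * y + 3 * d * y ^ 2 = 0 := by
  by_cases h0 : b ^ 2 - 3 * a * c = 0
  · by_cases h1 : c ^ 2 - 3 * b * d = 0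
    · have hh : b * c - 9 * a * d = 0 := by
        rw [h0] at hd
        exact pow_eq_zero_iff two_ne_zero |>.1 (by linear_combination hd)
      by_cases ha : a = 0
      · subst ha
        have hb : b = 0 := pow_eq_zero_iff two_ne_zero |>.1 (by linear_combination h0)
        refine ⟨1, 0, by simp, by ring, by rw [hb]; ring⟩
      · refine ⟨-b, 3 * a, fun h => mul_ne_zero h3 ha h.2, by linear_combination (-3 * a) * h0, ?_⟩
        linear_combination b * h0 - 3 * a * hh
    · refine ⟨2 * (c ^ 2 - 3 * b * d), -(b * c - 9 * a * d), fun h => mul_ne_zero h2 h1 h.1, ?_, ?_⟩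
      · linear_combination c * hd
      · linear_combination 3 * d * hd
  · refine ⟨-(b * c - 9 * a * d), 2 * (b ^ 2 - 3 * a * c), fun h => mul_ne_zero h2 h0 h.2, ?_, ?_⟩
    · linear_combination 3 * a * hd
    · linear_combination b * hd

theorem gauss_surj_aux [IsAlgClosed K] (h2 : (2 : K) ≠ 0) (h3 : (3 : K) ≠ 0) {μ : K}
    (hμ : μ ^ 3 ≠ 1) {u v t : K} (ht : t ≠ 0) (h : eval ![u, v, t] (dualS μ) = 0) :
    ∃ x y z : K, eval ![x, y, z] (hesse μ) = 0 ∧ gradVec (hesse μ) ![x, y, z] = ![u, v, t] := by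
  rw [eval_dual] at h
  simp only [Matrix.cons_val_zero, Matrix.cons_val_one, Matrix.cons_val] at h
  obtain ⟨x, y, hxy, e1, e2⟩ := double_root h2 h3 (t ^ 3 - u ^ 3)
    (-3 * u ^ 2 * v + 3 * μ * t ^ 2 * u) (-3 * u * v ^ 2 + 3 * μ * t ^ 2 * v) (t ^ 3 - v ^ 3)
    (by linear_combination 81 * t ^ 6 * h)
  have hP : (![t * x, t * y, -(u * x + v * y)] : Fin 3 → K) ≠ 0 := by
    intro h0
    have a0 := congrFun h0 0
    have a1 := congrFun h0 1
    simp [ht] at a0 a1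
    exact hxy ⟨a0, a1⟩
  have hg := grad_hesse_ne h3 hμ hP
  rw [grad_hesse] at hg
  simp only [Matrix.cons_val_zero, Matrix.cons_val_one, Matrix.cons_val] at hg
  set l := (3 * ((-(u * x + v * y)) ^ 2 - μ * (t * x * (t * y)))) / t with hl
  have l0 : 3 * ((t * x) ^ 2 - μ * (t * y * (-(u * x + v * y)))) = l * u := by
    rw [hl, div_mul_eq_mul_div, eq_div_iff ht]; linear_combination e1
  have l1 : 3 * ((t * y) ^ 2 - μ * (t * x * (-(u * x + v * y)))) = l * v := by
    rw [hl, div_mul_eq_mul_div, eq_div_iff ht]; linear_combination e2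
  have l2 : 3 * ((-(u * x + v * y)) ^ 2 - μ * (t * x * (t * y))) = l * t := by
    rw [hl, div_mul_cancel₀ _ ht]
  rw [l0, l1, l2] at hg
  have hl0 : l ≠ 0 := by
    intro h0
    apply hg
    ext i
    fin_cases i <;> simp [h0]
  obtain ⟨s, hs⟩ := IsAlgClosed.exists_pow_nat_eq (l⁻¹) (n := 2) (by norm_num)
  have hsl : s ^ 2 * l = 1 := by rw [hs, inv_mul_cancel₀ hl0]
  refine ⟨s * (t * x), s * (t * y), s * (-(u * x + v * y)), ?_, ?_⟩
  · apply mul_left_cancel₀ h3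
    rw [eval_hesse]
    simp only [Matrix.cons_val_zero, Matrix.cons_val_one, Matrix.cons_val]
    linear_combination s ^ 3 * (t * x * l0 + t * y * l1 - (u * x + v * y) * l2)
  · rw [grad_hesse]
    ext i
    fin_cases i
    · simp; linear_combination s ^ 2 * l0 + u * hsl
    · simp; linear_combination s ^ 2 * l1 + v * hsl
    · simp; linear_combination s ^ 2 * l2 + t * hsl

theorem gauss_surj [IsAlgClosed K] (h2 : (2 : K) ≠ 0) (h3 : (3 : K) ≠ 0) {μ : K}
    (hμ : μ ^ 3 ≠ 1) (w : Fin 3 → K) (h : eval w (dualS μ) = 0) :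
    ∃ p, eval p (hesse μ) = 0 ∧ gradVec (hesse μ) p = w := by
  by_cases c2 : w 2 = 0
  · by_cases c1 : w 1 = 0
    · by_cases c0 : w 0 = 0
      · refine ⟨0, by rw [eval_hesse]; simp, ?_⟩
        rw [grad_hesse]
        ext i
        fin_cases i <;> simp [c0, c1, c2]
      · obtain ⟨x, y, z, k1, k2⟩ := gauss_surj_aux h2 h3 hμ (u := w 1) (v := w 2) c0
          (by rw [eval_dual] at h ⊢; simp; linear_combination h)
        refine ⟨![z, x, y], ?_, ?_⟩
        · rw [eval_hesse] at k1 ⊢; simp at k1 ⊢; linear_combination k1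
        · rw [grad_hesse] at k2 ⊢
          have a0 := congrFun k2 0
          have a1 := congrFun k2 1
          have a2 := congrFun k2 2
          simp at a0 a1 a2
          ext i
          fin_cases i
          · simp; linear_combination a2
          · simp; linear_combination a0
          · simp; linear_combination a1
    · obtain ⟨x, y, z, k1, k2⟩ := gauss_surj_aux h2 h3 hμ (u := w 2) (v := w 0) c1
          (by rw [eval_dual] at h ⊢; simp; linear_combination h)
      refine ⟨![y, z, x], ?_, ?_⟩
      · rw [eval_hesse] at k1 ⊢; simp at k1 ⊢; linear_combination k1
      · rw [grad_hesse] at k2 ⊢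
        have a0 := congrFun k2 0
        have a1 := congrFun k2 1
        have a2 := congrFun k2 2
        simp at a0 a1 a2
        ext i
        fin_cases i
        · simp; linear_combination a1
        · simp; linear_combination a2
        · simp; linear_combination a0
  · obtain ⟨x, y, z, k1, k2⟩ := gauss_surj_aux h2 h3 hμ (u := w 0) (v := w 1) c2
          (by rw [eval_dual] at h ⊢; simp; linear_combination h)
    refine ⟨![x, y, z], k1, k2.trans ?_⟩
    ext i
    fin_cases i <;> simp

theorem dvd_of_zeros [IsAlgClosed K] {q A : MvPolynomial (Fin 3) K} (hq : Prime q)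
    (h : ∀ w, eval w q = 0 → eval w A = 0) : q ∣ A := by
  have hP : (Ideal.span {q}).IsPrime := (Ideal.span_singleton_prime hq.ne_zero).2 hq
  rw [← Ideal.mem_span_singleton, ← MvPolynomial.IsPrime.vanishingIdeal_zeroLocus (K := K)
    (Ideal.span {q}), MvPolynomial.mem_vanishingIdeal_iff]
  intro x hx
  have := hx q (Ideal.mem_span_singleton_self q)
  rw [MvPolynomial.aeval_eq_eval] at this ⊢
  exact h x this

/-- no section of the Hesse cubic -/
theorem no_root (h2 : (2 : K) ≠ 0) (h3 : (3 : K) ≠ 0) {μ : K} (hμ : μ ^ 3 ≠ 1)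
    (r : MvPolynomial (Fin 2) K)
    (h : r ^ 3 + X 0 ^ 3 + X 1 ^ 3 - MvPolynomial.C (3 * μ) * (r * X 0 * X 1) = 0) : False := by
  have r0 : MvPolynomial.constantCoeff r = 0 := by
    have := congrArg (fun f => MvPolynomial.constantCoeff f) h
    simpa using this
  have h6 : (6 : K) ≠ 0 := by
    have : (6 : K) = 2 * 3 := by norm_num
    rw [this]; exact mul_ne_zero h2 h3
  have q1 := congrArg (fun f => MvPolynomial.constantCoeff (pderiv 0 (pderiv 0 (pderiv 0 f)))) h
  have q2 := congrArg (fun f => MvPolynomial.constantCoeff (pderiv 1 (pderiv 1 (pderiv 1 f)))) h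
  have q3 := congrArg (fun f => MvPolynomial.constantCoeff (pderiv 1 (pderiv 0 (pderiv 0 f)))) h
  have n2 (i : Fin 2) : pderiv i (2 : MvPolynomial (Fin 2) K) = 0 := by
    rw [← map_ofNat MvPolynomial.C 2, pderiv_C]
  have n3 (i : Fin 2) : pderiv i (3 : MvPolynomial (Fin 2) K) = 0 := by
    rw [← map_ofNat MvPolynomial.C 3, pderiv_C]
  have k2 : MvPolynomial.constantCoeff (2 : MvPolynomial (Fin 2) K) = 2 := map_ofNat MvPolynomial.constantCoeff 2
  have k3 : MvPolynomial.constantCoeff (3 : MvPolynomial (Fin 2) K) = 3 := map_ofNat MvPolynomial.constantCoeff 3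
  simp [Derivation.leibniz, Derivation.leibniz_pow, pderiv_X, r0, n2, n3, k2, k3] at q1 q2 q3
  generalize MvPolynomial.constantCoeff (pderiv 0 r) = a at *
  generalize MvPolynomial.constantCoeff (pderiv 1 r) = b at *
  have a3 : a ^ 3 = -1 := by
    apply mul_left_cancel₀ h6; linear_combination q1
  have b3 : b ^ 3 = -1 := by
    apply mul_left_cancel₀ h6; linear_combination q2
  have ha : a ≠ 0 := by rintro rfl; simp at a3
  have hab : a * b = μ := by
    apply mul_left_cancel₀ (mul_ne_zero h6 ha); linear_combination q3
  apply hμ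
  rw [← hab]
  linear_combination b ^ 3 * a3 - b3

theorem hesse_irreducible (h2 : (2 : K) ≠ 0) (h3 : (3 : K) ≠ 0) {μ : K} (hμ : μ ^ 3 ≠ 1) :
    Irreducible (hesse μ) := by
  rw [← MulEquiv.irreducible_iff (MvPolynomial.finSuccEquiv K 2)]
  have e1 : (1 : Fin 3) = Fin.succ 0 := rfl
  have e2 : (2 : Fin 3) = Fin.succ 1 := rfl
  have hE : MvPolynomial.finSuccEquiv K 2 (hesse μ) = Polynomial.X ^ 3 +
      (Polynomial.C (-(MvPolynomial.C (3 * μ) * X 0 * X 1)) * Polynomial.X +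
      Polynomial.C (X 0 ^ 3 + X 1 ^ 3)) := by
    simp only [hesse, e1, e2, map_add, map_sub, map_mul, map_pow, map_neg,
      MvPolynomial.finSuccEquiv_X_zero, MvPolynomial.finSuccEquiv_X_succ]
    have hC : ∀ a : K, MvPolynomial.finSuccEquiv K 2 (MvPolynomial.C a) =
        Polynomial.C (MvPolynomial.C a) := by
      intro a
      refine (AlgEquiv.eq_symm_apply _).1 ?_
      exact (RingHom.congr_fun (MvPolynomial.finSuccEquiv_comp_C_eq_C (R := K) 2) a).symm
    rw [hC, hC]
    ring
  rw [hE]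
  have hdeg : (Polynomial.C (-(MvPolynomial.C (3 * μ) * X 0 * X 1)) * Polynomial.X +
      Polynomial.C (X 0 ^ 3 + X 1 ^ 3) : Polynomial (MvPolynomial (Fin 2) K)).degree < (3 : ℕ) :=
    lt_of_le_of_lt Polynomial.degree_linear_le (by norm_num)
  have hm := Polynomial.monic_X_pow_add hdeg
  have hX3 : (Polynomial.X ^ 3 : Polynomial (MvPolynomial (Fin 2) K)).degree = (3 : ℕ) :=
    Polynomial.degree_X_pow 3
  rw [← hX3] at hdeg
  have hn := Polynomial.natDegree_eq_of_degree_eq_some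
    ((Polynomial.degree_add_eq_left_of_degree_lt hdeg).trans hX3)
  rw [hm.irreducible_iff_roots_eq_zero_of_degree_le_three (by rw [hn]; norm_num)
    (by rw [hn])]
  apply Multiset.eq_zero_of_forall_notMem
  intro r hr
  have hr' := Polynomial.isRoot_of_mem_roots hr
  rw [Polynomial.IsRoot.def] at hr'
  simp only [Polynomial.eval_add, Polynomial.eval_mul, Polynomial.eval_pow, Polynomial.eval_X,
    Polynomial.eval_C] at hr'
  exact no_root h2 h3 hμ r (by linear_combination hr')

theorem dual_irreducible [IsAlgClosed K] (h2 : (2 : K) ≠ 0) (h3 : (3 : K) ≠ 0) {μ : K}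
    (hμ : μ ^ 3 ≠ 1) (hs : Squarefree (dualS μ)) : Irreducible (dualS μ) := by
  have hF : Prime (hesse μ) := (hesse_irreducible h2 h3 hμ).prime
  have hD0 : dualS μ ≠ 0 := hs.ne_zero
  let Γ : MvPolynomial (Fin 3) K →ₐ[K] MvPolynomial (Fin 3) K :=
    MvPolynomial.aeval (fun i => pderiv i (hesse μ))
  have hΓ : ∀ A p, eval p (Γ A) = eval (gradVec (hesse μ) p) A := by
    intro A p
    induction A using MvPolynomial.induction_on with
    | C a => simp
    | add p q hp hq => simp [hp, hq]
    | mul_X q n hq =>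
      have hX : Γ (MvPolynomial.X n) = pderiv n (hesse μ) := by simp [Γ]
      rw [map_mul, map_mul, hq, hX, map_mul, MvPolynomial.eval_X]
      rfl
  have key : ∀ A B : MvPolynomial (Fin 3) K, dualS μ = A * B → hesse μ ∣ Γ A → IsUnit B := by
    intro A B hAB hA
    by_contra hB
    have hB0 : B ≠ 0 := by rintro rfl; exact hD0 (by rw [hAB, mul_zero])
    obtain ⟨q, hq, hqB⟩ := WfDvdMonoid.exists_irreducible_factor hB hB0
    have hqA : q ∣ A := by
      apply dvd_of_zeros hq.prime
      intro w hw
      obtain ⟨B', rfl⟩ := hqB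
      obtain ⟨p, hp, rfl⟩ := gauss_surj h2 h3 hμ w (by rw [hAB]; simp [hw])
      rw [← hΓ]
      obtain ⟨A', hA'⟩ := hA
      rw [hA', map_mul, hp, zero_mul]
    exact hq.not_isUnit (hs q (by rw [hAB]; exact mul_dvd_mul hqA hqB))
  refine ⟨?_, ?_⟩
  · intro hu
    have h0 := (cusp_dual h3 h2 hμ).1.1
    have := hu.map (MvPolynomial.eval ![μ, 1, 1])
    rw [h0] at this
    exact not_isUnit_zero this
  · intro A B hAB
    have hd : hesse μ ∣ Γ (dualS μ) := by
      apply dvd_of_zeros hF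
      intro p hp
      rw [hΓ]
      exact dual_gauss hp
    rw [hAB, map_mul] at hd
    rcases hF.dvd_or_dvd hd with h | h
    · exact Or.inr (key A B hAB h)
    · exact Or.inl (key B A (by rw [hAB, mul_comm]) h)

/-- nonsingularity -/
def Nons (F : MvPolynomial (Fin 3) K) : Prop :=
  ∀ p : Fin 3 → K, p ≠ 0 → eval p F = 0 → gradVec F p ≠ 0

/-- projective equivalence of pairs (curve, line) -/
def Eqv (F : MvPolynomial (Fin 3) K) (w : Fin 3 → K) (F' : MvPolynomial (Fin 3) K)
    (w' : Fin 3 → K) : Prop :=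
  ∃ M N : Matrix (Fin 3) (Fin 3) K, M * N = 1 ∧ N * M = 1 ∧ subst M F = F' ∧
    ∃ c : K, c ≠ 0 ∧ M.transpose.mulVec w = c • w'

theorem Eqv.trans {F F' F'' : MvPolynomial (Fin 3) K} {w w' w'' : Fin 3 → K}
    (h : Eqv F w F' w') (h' : Eqv F' w' F'' w'') : Eqv F w F'' w'' := by
  obtain ⟨M, N, h1, h2, h3, c, hc, h4⟩ := h
  obtain ⟨M', N', h1', h2', h3', c', hc', h4'⟩ := h'
  refine ⟨M * M', N' * N, ?_, ?_, ?_, c * c', mul_ne_zero hc hc', ?_⟩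
  · rw [Matrix.mul_assoc, ← Matrix.mul_assoc M', h1', Matrix.one_mul, h1]
  · rw [Matrix.mul_assoc, ← Matrix.mul_assoc N, h2, Matrix.one_mul, h2']
  · rw [← subst_subst, h3, h3']
  · rw [Matrix.transpose_mul, ← Matrix.mulVec_mulVec, h4, Matrix.mulVec_smul, h4', smul_smul]

theorem Eqv.of_det {F F' : MvPolynomial (Fin 3) K} {w w' : Fin 3 → K}
    (M : Matrix (Fin 3) (Fin 3) K) (hM : M.det ≠ 0) (hs : subst M F = F')
    (c : K) (hc : c ≠ 0) (hw : M.transpose.mulVec w = c • w') : Eqv F w F' w' :=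
  ⟨M, M⁻¹, Matrix.mul_nonsing_inv M (isUnit_iff_ne_zero.2 hM),
    Matrix.nonsing_inv_mul M (isUnit_iff_ne_zero.2 hM), hs, c, hc, hw⟩

theorem Eqv.nons {F F' : MvPolynomial (Fin 3) K} {w w' : Fin 3 → K}
    (h : Eqv F w F' w') (hF : Nons F) : Nons F' := by
  obtain ⟨M, N, h1, h2, rfl, -⟩ := h
  intro p hp h0 hg
  rw [eval_subst] at h0
  rw [gradVec_subst] at hg
  refine hF _ ?_ h0 ?_
  · intro h
    apply hp
    rw [← mulVec_cancel h2 p, h, Matrix.mulVec_zero]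
  · have h3 : N.transpose * M.transpose = 1 := by
      rw [← Matrix.transpose_mul, h1, Matrix.transpose_one]
    rw [← mulVec_cancel h3 (gradVec F _), hg, Matrix.mulVec_zero]

/-- cubics with a flex at `(0,1,0)` and flex line `z = 0` -/
def wf (A b1 b2 b3 b4 b5 b6 : K) : MvPolynomial (Fin 3) K :=
  MvPolynomial.C A * X 0 ^ 3 + X 2 * (MvPolynomial.C b1 * X 0 ^ 2 + MvPolynomial.C b2 * X 0 * X 1 +
    MvPolynomial.C b3 * X 1 ^ 2 + MvPolynomial.C b4 * X 0 * X 2 + MvPolynomial.C b5 * X 1 * X 2 +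
    MvPolynomial.C b6 * X 2 ^ 2)

theorem eval_wf (A b1 b2 b3 b4 b5 b6 : K) (p : Fin 3 → K) : eval p (wf A b1 b2 b3 b4 b5 b6) =
    A * p 0 ^ 3 + p 2 * (b1 * p 0 ^ 2 + b2 * p 0 * p 1 + b3 * p 1 ^ 2 + b4 * p 0 * p 2 +
      b5 * p 1 * p 2 + b6 * p 2 ^ 2) := by
  simp [wf]

theorem mulVec3 (a b c d e f g h i : K) (p : Fin 3 → K) :
    (!![a, b, c; d, e, f; g, h, i]).mulVec p = ![a * p 0 + b * p 1 + c * p 2,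
      d * p 0 + e * p 1 + f * p 2, g * p 0 + h * p 1 + i * p 2] := by
  ext j
  fin_cases j <;> simp [Matrix.mulVec, dotProduct, Fin.sum_univ_three]

theorem line_wf (c : ℕ → ℕ → ℕ → K) (a b : Fin 3 → K) (ha : a = ![0, 1, 0]) (hb : b = ![1, 0, 0])
    (F : MvPolynomial (Fin 3) K) (hc : F = ∑ i ∈ Finset.range (3 + 1),
      ∑ j ∈ Finset.range (3 + 1 - i),
      MvPolynomial.C (c i j (3 - i - j)) * MvPolynomial.X 0 ^ i * MvPolynomial.X 1 ^ j *
        MvPolynomial.X 2 ^ (3 - i - j)) :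
    lineRestrict F a b = Polynomial.C (c 0 3 0) + Polynomial.C (c 1 2 0) * Polynomial.X +
      Polynomial.C (c 2 1 0) * Polynomial.X ^ 2 + Polynomial.C (c 3 0 0) * Polynomial.X ^ 3 := by
  subst ha hb hc
  simp [lineRestrict, Finset.sum_range_succ]

theorem nf_first {F : MvPolynomial (Fin 3) K} (hF : F.IsHomogeneous 3) {w : Fin 3 → K}
    (hw : IsInflLine F w) : ∃ A b1 b2 b3 b4 b5 b6 : K, A ≠ 0 ∧
      Eqv F w (wf A b1 b2 b3 b4 b5 b6) ![0, 0, 1] := by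
  obtain ⟨hw0, a, b, wa, wb, hl, hne, hc⟩ := hw
  rw [contactAt, Polynomial.le_rootMultiplicity_iff hne] at hc
  simp only [map_zero, sub_zero] at hc
  rw [Polynomial.X_pow_dvd_iff] at hc
  have : ∃ i, w i ≠ 0 := by
    by_contra hcon
    push Not at hcon
    exact hw0 (funext hcon)
  obtain ⟨i, hi⟩ := this
  let e : Fin 3 → K := Pi.single i (w i)⁻¹
  have we : dotv w e = 1 := by
    simp [dotv, e, Pi.single_apply, hi]
  simp only [dotv, Fin.sum_univ_three] at wa wb we
  let M : Matrix (Fin 3) (Fin 3) K := !![b 0, a 0, e 0; b 1, a 1, e 1; b 2, a 2, e 2]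
  have hM : M.det ≠ 0 := by
    intro h0
    obtain ⟨v, hv, hMv⟩ := Matrix.exists_mulVec_eq_zero_iff.2 h0
    rw [mulVec3] at hMv
    have m0 := congrFun hMv 0
    have m1 := congrFun hMv 1
    have m2 := congrFun hMv 2
    simp at m0 m1 m2
    have v2 : v 2 = 0 := by
      linear_combination w 0 * m0 + w 1 * m1 + w 2 * m2 - v 0 * wb - v 1 * wa - v 2 * we
    rw [v2] at m0 m1 m2
    rw [LinearIndependent.pair_iff] at hl
    have := hl (v 1) (v 0) (by
      ext j
      fin_cases j
      · simp; linear_combination m0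
      · simp; linear_combination m1
      · simp; linear_combination m2)
    apply hv
    ext j
    fin_cases j
    · exact this.2
    · exact this.1
    · exact v2
  have hMw : M.transpose.mulVec w = (1 : K) • ![0, 0, 1] := by
    ext j
    fin_cases j
    · simp [M, Matrix.mulVec, dotProduct, Fin.sum_univ_three]; linear_combination wb
    · simp [M, Matrix.mulVec, dotProduct, Fin.sum_univ_three]; linear_combination wa
    · simp [M, Matrix.mulVec, dotProduct, Fin.sum_univ_three]; linear_combination we
  obtain ⟨c, hcF⟩ := homog_expand (homog_subst M hF)
  have hline := line_wf c ![0, 1, 0] ![1, 0, 0] rfl rfl _ hcF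
  rw [lineRestrict_subst] at hline
  have ea : M.mulVec ![0, 1, 0] = a := by
    rw [mulVec3]; ext j; fin_cases j <;> simp
  have eb : M.mulVec ![1, 0, 0] = b := by
    rw [mulVec3]; ext j; fin_cases j <;> simp
  rw [ea, eb] at hline
  have q0 := hc 0 (by norm_num)
  have q1 := hc 1 (by norm_num)
  have q2 := hc 2 (by norm_num)
  rw [hline] at q0 q1 q2
  simp only [Polynomial.coeff_add, Polynomial.coeff_C_mul, Polynomial.coeff_X_pow,
    Polynomial.coeff_X, Polynomial.coeff_C] at q0 q1 q2
  norm_num at q0 q1 q2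
  refine ⟨c 3 0 0, c 2 0 1, c 1 1 1, c 0 2 1, c 1 0 2, c 0 1 2, c 0 0 3, ?_,
    Eqv.of_det M hM ?_ 1 one_ne_zero hMw⟩
  · intro h
    apply hne
    rw [hline, q0, q1, q2, h]
    simp
  · rw [hcF]
    simp [Finset.sum_range_succ, wf, q0, q1, q2]
    ring

theorem nf_b3 {A b1 b2 b3 b4 b5 b6 : K} (h : Nons (wf A b1 b2 b3 b4 b5 b6)) : b3 ≠ 0 := by
  intro h0
  refine h ![0, 1, 0] ?_ ?_ ?_
  · intro h; simpa using congrFun h 1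
  · rw [eval_wf]; simp
  · ext i
    fin_cases i <;> simp [gradVec, wf, pderiv_X, h0]

theorem nf_short [IsAlgClosed K] (h2 : (2 : K) ≠ 0) (h3 : (3 : K) ≠ 0)
    {A b1 b2 b3 b4 b5 b6 : K} (hA : A ≠ 0) (hb3 : b3 ≠ 0) :
    ∃ p q : K, Eqv (wf A b1 b2 b3 b4 b5 b6) ![0, 0, 1] (wf 1 0 0 (-1) p 0 q) ![0, 0, 1] := by
  have h4 : (4 : K) ≠ 0 := by
    have : (4 : K) = 2 * 2 := by norm_num
    rw [this]; exact mul_ne_zero h2 h2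
  have stepa : Eqv (wf A b1 b2 b3 b4 b5 b6) ![0, 0, 1]
      (wf A (b1 - b2 ^ 2 / (4 * b3)) 0 b3 (b4 - b2 * b5 / (2 * b3)) 0 (b6 - b5 ^ 2 / (4 * b3)))
      ![0, 0, 1] := by
    refine Eqv.of_det !![1, 0, 0; -b2 / (2 * b3), 1, -b5 / (2 * b3); 0, 0, 1] ?_ ?_ 1 one_ne_zero ?_
    · simp [Matrix.det_fin_three]
    · apply MvPolynomial.funext
      intro p
      rw [eval_subst, mulVec3, eval_wf, eval_wf]
      simp only [Matrix.cons_val_zero, Matrix.cons_val_one, Matrix.cons_val]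
      field_simp
      ring
    · ext i; fin_cases i <;> simp [Matrix.mulVec, dotProduct, Fin.sum_univ_three]
  have stepb : ∀ c1 c4 c6 : K, Eqv (wf A c1 0 b3 c4 0 c6) ![0, 0, 1]
      (wf A 0 0 b3 (3 * A * (c1 / (3 * A)) ^ 2 - 2 * c1 * (c1 / (3 * A)) + c4) 0
        (- A * (c1 / (3 * A)) ^ 3 + c1 * (c1 / (3 * A)) ^ 2 - c4 * (c1 / (3 * A)) + c6))
      ![0, 0, 1] := by
    intro c1 c4 c6
    refine Eqv.of_det !![1, 0, -(c1 / (3 * A)); 0, 1, 0; 0, 0, 1] ?_ ?_ 1 one_ne_zero ?_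
    · simp [Matrix.det_fin_three]
    · apply MvPolynomial.funext
      intro p
      rw [eval_subst, mulVec3, eval_wf, eval_wf]
      simp only [Matrix.cons_val_zero, Matrix.cons_val_one, Matrix.cons_val]
      have : c1 = 3 * A * (c1 / (3 * A)) := by field_simp
      generalize c1 / (3 * A) = s at *
      rw [this]
      ring
    · ext i; fin_cases i <;> simp [Matrix.mulVec, dotProduct, Fin.sum_univ_three]
  obtain ⟨α, hα⟩ := IsAlgClosed.exists_pow_nat_eq (A⁻¹) (n := 3) (by norm_num)
  have hα1 : A * α ^ 3 = 1 := by rw [hα, mul_inv_cancel₀ hA]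
  have hα0 : α ≠ 0 := by rintro rfl; simp at hα1
  have stepc : ∀ c4 c6 : K, Eqv (wf A 0 0 b3 c4 0 c6) ![0, 0, 1]
      (wf 1 0 0 (-1) (α * c4 * (-b3⁻¹) ^ 2) 0 (c6 * (-b3⁻¹) ^ 3)) ![0, 0, 1] := by
    intro c4 c6
    refine Eqv.of_det !![α, 0, 0; 0, 1, 0; 0, 0, -b3⁻¹] ?_ ?_ (-b3⁻¹) (by simpa using hb3) ?_
    · simp [Matrix.det_fin_three, hα0, hb3]
    · apply MvPolynomial.funext
      intro p
      rw [eval_subst, mulVec3, eval_wf, eval_wf]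
      simp only [Matrix.cons_val_zero, Matrix.cons_val_one, Matrix.cons_val]
      have hb : b3 * b3⁻¹ = 1 := mul_inv_cancel₀ hb3
      generalize b3⁻¹ = s at *
      linear_combination p 0 ^ 3 * hα1 - p 2 * p 1 ^ 2 * hb
    · ext i; fin_cases i <;> simp [Matrix.mulVec, dotProduct, Fin.sum_univ_three]
  exact ⟨_, _, stepa.trans ((stepb _ _ _).trans (stepc _ _))⟩

/-- diagonal type cubics -/
def tf (τ κ l : K) : MvPolynomial (Fin 3) K :=
  MvPolynomial.C τ * X 0 ^ 3 - MvPolynomial.C κ * (X 1 ^ 3 + X 2 ^ 3) +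
    MvPolynomial.C l * (X 0 * X 1 * X 2)

theorem eval_tf (τ κ l : K) (p : Fin 3 → K) : eval p (tf τ κ l) =
    τ * p 0 ^ 3 - κ * (p 1 ^ 3 + p 2 ^ 3) + l * (p 0 * p 1 * p 2) := by
  simp [tf]

theorem nf_tf [IsAlgClosed K] (h2 : (2 : K) ≠ 0) (h3 : (3 : K) ≠ 0) {A B : K}
    (hn : Nons (wf 1 0 0 (-1) A 0 B)) : ∃ τ κ σ : K, κ ≠ 0 ∧ τ ≠ 0 ∧
      Eqv (wf 1 0 0 (-1) A 0 B) ![0, 0, 1] (tf τ κ (3 * σ * κ)) ![σ, 1, 1] := by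
  have hroot : ∃ x : K, 3 * x ^ 4 + 6 * A * x ^ 2 + 12 * B * x - A ^ 2 = 0 := by
    let P : Polynomial K := Polynomial.C 3 * Polynomial.X ^ 4 + Polynomial.C (6 * A) * Polynomial.X ^ 2 +
      Polynomial.C (12 * B) * Polynomial.X + Polynomial.C (-A ^ 2)
    have hd : P.degree ≠ 0 := by
      have h4 : P.coeff 4 = 3 := by
        simp only [P, Polynomial.coeff_add, Polynomial.coeff_C_mul, Polynomial.coeff_X_pow,
          Polynomial.coeff_X, Polynomial.coeff_C]
        norm_num
      intro h0
      have : P.coeff 4 = 0 := Polynomial.coeff_eq_zero_of_degree_lt (by rw [h0]; norm_num)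
      exact h3 (h4.symm.trans this)
    obtain ⟨x, hx⟩ := IsAlgClosed.exists_root P hd
    refine ⟨x, ?_⟩
    rw [Polynomial.IsRoot.def] at hx
    simp only [P, Polynomial.eval_add, Polynomial.eval_mul, Polynomial.eval_pow,
      Polynomial.eval_X, Polynomial.eval_C] at hx
    linear_combination hx
  obtain ⟨x, hx⟩ := hroot
  obtain ⟨y, hy⟩ := IsAlgClosed.exists_pow_nat_eq (x ^ 3 + A * x + B) (n := 2) (by norm_num)
  have hy0 : y ≠ 0 := by
    rintro rfl
    have hd : 3 * x ^ 2 + A = 0 := pow_eq_zero_iff two_ne_zero |>.1 (by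
      linear_combination -12 * x * hy - hx)
    have hf : x ^ 3 + A * x + B = 0 := by linear_combination -hy
    refine hn ![x, 0, 1] ?_ ?_ ?_
    · intro h; simpa using congrFun h 2
    · rw [eval_wf]; simp; linear_combination hf
    · ext i
      fin_cases i
      · simp [gradVec, wf, pderiv_X]; linear_combination hd
      · simp [gradVec, wf, pderiv_X]
      · simp [gradVec, wf, pderiv_X]; linear_combination 3 * hf - x * hd
  obtain ⟨ω, hω⟩ : ∃ ω : K, ω ^ 2 + ω + 1 = 0 := by
    obtain ⟨d, hd⟩ := IsAlgClosed.exists_pow_nat_eq (-3 : K) (n := 2) (by norm_num)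
    refine ⟨(-1 + d) / 2, ?_⟩
    field_simp
    linear_combination hd
  set s := (3 * x ^ 2 + A) / (2 * y) with hs
  have hs1 : 2 * y * s = 3 * x ^ 2 + A := by rw [hs]; field_simp
  have hs2 : s ^ 2 = 3 * x := by
    apply mul_left_cancel₀ (mul_ne_zero (mul_ne_zero h2 h2) (pow_ne_zero 2 hy0))
    linear_combination (2 * y * s + 3 * x ^ 2 + A) * hs1 - 12 * x * hy - hx
  set κ := (2 * y)⁻¹ with hκ
  have hκ1 : 2 * y * κ = 1 := mul_inv_cancel₀ (mul_ne_zero h2 hy0)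
  have hκ0 : κ ≠ 0 := inv_ne_zero (mul_ne_zero h2 hy0)
  set σ := 2 * s / 3 with hσ
  have hσ1 : 3 * σ = 2 * s := by rw [hσ]; field_simp
  have hsσ : s = 3 * σ / 2 := by rw [hσ]; field_simp
  have hE : Eqv (wf 1 0 0 (-1) A 0 B) ![0, 0, 1] (tf (1 - κ * σ ^ 3) κ (3 * σ * κ))
      ![σ, 1, 1] := by
    refine Eqv.of_det !![1 - x * κ * σ, -x * κ, -x * κ; 0, (ω ^ 2 - ω) / 2, -((ω ^ 2 - ω) / 2);
      -κ * σ, -κ, -κ] ?_ ?_ (-κ) (neg_ne_zero.2 hκ0) ?_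
    · have : Matrix.det !![1 - x * κ * σ, -x * κ, -x * κ;
          0, (ω ^ 2 - ω) / 2, -((ω ^ 2 - ω) / 2); -κ * σ, -κ, -κ] = -κ * (ω ^ 2 - ω) := by
        simp [Matrix.det_fin_three]; field_simp; ring
      rw [this]
      refine mul_ne_zero (neg_ne_zero.2 hκ0) ?_
      intro h0
      apply h3
      linear_combination (-(ω ^ 2 - ω)) * h0 + (ω ^ 2 - 3 * ω + 3) * hω
    · apply MvPolynomial.funext
      intro p
      rw [eval_subst, mulVec3, eval_wf, eval_tf]
      simp only [Matrix.cons_val_zero, Matrix.cons_val_one, Matrix.cons_val]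
      -- the tangent line decomposition
      have hdec : ∀ X Y Z : K, X ^ 3 + A * X * Z ^ 2 + B * Z ^ 3 - Y ^ 2 * Z =
          (X - x * Z) ^ 3 + Z * ((y * Z + s * (X - x * Z)) - Y) *
            ((y * Z + s * (X - x * Z)) + Y) := by
        intro X Y Z
        linear_combination (-(Z ^ 2 * (X - x * Z))) * hs1 - (Z * (X - x * Z) ^ 2) * hs2 -
          Z ^ 3 * hy
      generalize p 0 = m
      generalize p 1 = P
      generalize p 2 = Q
      have hX := hdec ((1 - x * κ * σ) * m + -x * κ * P + -x * κ * Q)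
        (0 * m + (ω ^ 2 - ω) / 2 * P + -((ω ^ 2 - ω) / 2) * Q) (-κ * σ * m + -κ * P + -κ * Q)
      have hm : (1 - x * κ * σ) * m + -x * κ * P + -x * κ * Q -
          x * (-κ * σ * m + -κ * P + -κ * Q) = m := by ring
      rw [hm] at hX
      have hw2 : ω ^ 2 = -1 - ω := by linear_combination hω
      have hL : y * (-κ * σ * m + -κ * P + -κ * Q) + s * m = σ * m - (P + Q) / 2 := by
        rw [hsσ]
        field_simp
        linear_combination (-(σ * m + P + Q)) * hκ1
      have hv : y * (-κ * σ * m + -κ * P + -κ * Q) + s * m -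
          (0 * m + (ω ^ 2 - ω) / 2 * P + -((ω ^ 2 - ω) / 2) * Q) =
          σ * m + ω * P + ω ^ 2 * Q := by
        rw [hL, hw2]; field_simp; ring
      have hw : y * (-κ * σ * m + -κ * P + -κ * Q) + s * m +
          (0 * m + (ω ^ 2 - ω) / 2 * P + -((ω ^ 2 - ω) / 2) * Q) =
          σ * m + ω ^ 2 * P + ω * Q := by
        rw [hL, hw2]; field_simp; ring
      rw [hv, hw] at hX
      have hprod : (σ * m + P + Q) * (σ * m + ω * P + ω ^ 2 * Q) * (σ * m + ω ^ 2 * P + ω * Q) =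
          (σ * m) ^ 3 + P ^ 3 + Q ^ 3 - 3 * (σ * m) * P * Q := by
        rw [hw2]
        have hw3 : ω * (-1 - ω) = 1 := by linear_combination -hω
        generalize σ * m = S
        linear_combination (P^2*Q + P*Q^2 + 2*S*P*Q - S*P^2 - S*Q^2 - P^3 - Q^3) * hω
      linear_combination hX - κ * hprod
    · ext i; fin_cases i <;> simp [Matrix.mulVec, dotProduct, Fin.sum_univ_three]
  refine ⟨_, κ, σ, hκ0, ?_, hE⟩
  intro h0
  refine hE.nons hn ![1, 0, 0] ?_ ?_ ?_
  · intro h; simpa using congrFun h 0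
  · rw [eval_tf, h0]; simp
  · rw [h0]
    ext i
    fin_cases i <;> simp [gradVec, tf, pderiv_X]

theorem nf_hesse [IsAlgClosed K] (h3 : (3 : K) ≠ 0) {τ κ σ : K} (hτ : τ ≠ 0) (hκ : κ ≠ 0) :
    ∃ μ : K, Eqv (tf τ κ (3 * σ * κ)) ![σ, 1, 1] (hesse μ) ![μ, 1, 1] := by
  obtain ⟨α, hα⟩ := IsAlgClosed.exists_pow_nat_eq (τ⁻¹) (n := 3) (by norm_num)
  have hα1 : τ * α ^ 3 = 1 := by rw [hα, mul_inv_cancel₀ hτ]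
  have hα0 : α ≠ 0 := by rintro rfl; simp at hα1
  obtain ⟨ρ, hρ⟩ := IsAlgClosed.exists_pow_nat_eq (-κ⁻¹) (n := 3) (by norm_num)
  have hρ1 : κ * ρ ^ 3 = -1 := by rw [hρ, mul_neg, mul_inv_cancel₀ hκ]
  have hρ0 : ρ ≠ 0 := by rintro rfl; simp at hρ1
  refine ⟨-(σ * κ * α * ρ ^ 2), Eqv.of_det !![α, 0, 0; 0, ρ, 0; 0, 0, ρ] ?_ ?_ ρ hρ0 ?_⟩
  · simp [Matrix.det_fin_three, hα0, hρ0]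
  · apply MvPolynomial.funext
    intro p
    rw [eval_subst, mulVec3, eval_tf, eval_hesse]
    simp only [Matrix.cons_val_zero, Matrix.cons_val_one, Matrix.cons_val]
    linear_combination p 0 ^ 3 * hα1 - (p 1 ^ 3 + p 2 ^ 3) * hρ1
  · ext i
    fin_cases i
    · simp [Matrix.mulVec, dotProduct, Fin.sum_univ_three]; linear_combination σ * α * hρ1
    · simp [Matrix.mulVec, dotProduct, Fin.sum_univ_three]
    · simp [Matrix.mulVec, dotProduct, Fin.sum_univ_three]

theorem normal_form [IsAlgClosed K] (h2 : (2 : K) ≠ 0) (h3 : (3 : K) ≠ 0)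
    {F : MvPolynomial (Fin 3) K} (hF : IsSmoothCurve F 3) {w : Fin 3 → K} (hw : IsInflLine F w) :
    ∃ μ : K, μ ^ 3 ≠ 1 ∧ Eqv F w (hesse μ) ![μ, 1, 1] := by
  have hn : Nons F := by
    intro p hp h0 hg
    obtain ⟨i, hi⟩ := hF.2.2 p hp h0
    exact hi (congrFun hg i)
  obtain ⟨A, b1, b2, b3, b4, b5, b6, hA, e1⟩ := nf_first hF.1 hw
  obtain ⟨p, q, e2⟩ := nf_short h2 h3 (b1 := b1) (b2 := b2) (b4 := b4) (b5 := b5) (b6 := b6) hA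
    (nf_b3 (e1.nons hn))
  have e12 := e1.trans e2
  obtain ⟨τ, κ, σ, hκ, hτ, e3⟩ := nf_tf h2 h3 (e12.nons hn)
  obtain ⟨μ, e4⟩ := nf_hesse h3 (σ := σ) hτ hκ
  have e := e12.trans (e3.trans e4)
  refine ⟨μ, ?_, e⟩
  intro hμ
  refine e.nons hn ![μ ^ 2, 1, 1] ?_ ?_ ?_
  · intro h; simpa using congrFun h 1
  · rw [eval_hesse]; simp; linear_combination (μ ^ 3 - 2) * hμ
  · rw [grad_hesse]
    ext i
    fin_cases i
    · simp; right; linear_combination μ * hμ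
    · simp; right; linear_combination -hμ
    · simp; right; linear_combination -hμ

theorem exists_omega [IsAlgClosed K] (h2 : (2 : K) ≠ 0) : ∃ ω : K, ω ^ 2 + ω + 1 = 0 := by
  obtain ⟨s, hs⟩ := IsAlgClosed.exists_pow_nat_eq (-3 : K) (n := 2) (by norm_num)
  refine ⟨(-1 + s) / 2, ?_⟩
  field_simp
  linear_combination hs

theorem main_closed [IsAlgClosed K] (h2 : (2 : K) ≠ 0) (h3 : (3 : K) ≠ 0)
    {F G : MvPolynomial (Fin 3) K} (hF : IsSmoothCurve F 3) (hG6 : G.IsHomogeneous 6)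
    (hred : Squarefree G)
    (hsing : ∀ w : Fin 3 → K, IsInflLine F w → SingAt G w)
    (hcusp : ∃ w : Fin 3 → K, IsInflLine F w ∧ IsCuspAt G w) :
    Irreducible G ∧ ContainsGaussImage G F ∧
      ∀ w : Fin 3 → K, IsInflLine F w → IsCuspAt G w := by
  obtain ⟨w, hw, hwc⟩ := hcusp
  obtain ⟨μ, hμ, M, N, hMN, hNM, hsub, c, hc, hMw⟩ := normal_form h2 h3 hF hw
  obtain ⟨ω, hω⟩ := exists_omega (K := K) h2
  have hMN' : N.transpose * M.transpose = 1 := by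
    rw [← Matrix.transpose_mul, hMN, Matrix.transpose_one]
  have hNM' : M.transpose * N.transpose = 1 := by
    rw [← Matrix.transpose_mul, hNM, Matrix.transpose_one]
  obtain ⟨T, hT⟩ : ∃ T : Matrix (Fin 3) (Fin 3) K, T = c • N.transpose := ⟨_, rfl⟩
  obtain ⟨S, hS⟩ : ∃ S : Matrix (Fin 3) (Fin 3) K, S = c⁻¹ • M.transpose := ⟨_, rfl⟩
  have hTS : T * S = 1 := by
    rw [hT, hS, Matrix.smul_mul, Matrix.mul_smul, hMN', smul_smul, mul_inv_cancel₀ hc, one_smul]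
  have hST : S * T = 1 := by
    rw [hT, hS, Matrix.smul_mul, Matrix.mul_smul, hNM', smul_smul, inv_mul_cancel₀ hc, one_smul]
  have hSw : S.mulVec w = ![μ, 1, 1] := by
    rw [hS, Matrix.smul_mulVec, hMw, smul_smul, inv_mul_cancel₀ hc, one_smul]
  have hTw : T.mulVec ![μ, 1, 1] = w := by rw [← hSw, mulVec_cancel hTS]
  have hFN : subst N (hesse μ) = F := by rw [← hsub, subst_subst, hMN, subst_one]
  have hGS : subst S (subst T G) = G := by rw [subst_subst, hTS, subst_one]
  have hs : ∀ v, IsInflLine (hesse μ) v → SingAt (subst T G) v := by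
    intro v hv
    apply singAt_subst
    apply hsing
    rw [← hsub] at hv
    rw [hT, Matrix.smul_mulVec]
    exact inflLine_subst M N hNM F v c hc hv
  have hcu : IsCuspAt (subst T G) ![μ, 1, 1] := by
    apply cuspAt_subst T S hTS hST
    rwa [hTw]
  obtain ⟨p, q, r, t, hsym, e1, e2⟩ := sextic_normal h3 h2 hμ hω (subst T G) (homog_subst T hG6)
    (fun ε hε => hs _ (infl_hesse0 hμ hε))
    (fun ε hε => hs _ (infl_hesse_rot (infl_hesse0 hμ hε)))
    (fun ε hε => hs _ (infl_hesse_rot (infl_hesse_rot (infl_hesse0 hμ hε))))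
  rw [hsym] at hcu
  have hD := cusp_forces_dual h3 h2 hμ hcu e1 e2
  rw [← hsym] at hD
  have hsq : Squarefree (subst T G) := squarefree_subst T S hTS hST hred
  have hp : p ≠ 0 := by
    rintro rfl
    apply hsq.ne_zero
    rw [hD]; simp
  have hdsq : Squarefree (dualS μ) := hsq.squarefree_of_dvd ⟨MvPolynomial.C p, by rw [hD, mul_comm]⟩
  have hirr := dual_irreducible h2 h3 hμ hdsq
  have hu : IsUnit (MvPolynomial.C p : MvPolynomial (Fin 3) K) :=
    (isUnit_iff_ne_zero.2 hp).map MvPolynomial.C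
  have hirr' : Irreducible (subst T G) := by
    rw [hD]
    exact (irreducible_isUnit_mul hu).2 hirr
  refine ⟨?_, ?_, ?_⟩
  · rw [← hGS]
    exact irreducible_subst S T hST hTS hirr'
  · intro x _ hx
    have hx' : eval (N.mulVec x) (hesse μ) = 0 := by
      rw [← eval_subst, hFN, hx]
    have hg := dual_gauss hx'
    rw [← hsub, gradVec_subst, mulVec_cancel hMN] at hg
    rw [← hGS, eval_subst, hD, map_mul, hS, Matrix.smul_mulVec]
    generalize M.transpose.mulVec (gradVec F x) = u at hg
    rw [eval_dual] at hg ⊢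
    simp only [Pi.smul_apply, smul_eq_mul]
    linear_combination (eval (c⁻¹ • u) (MvPolynomial.C p) * c⁻¹ ^ 6) * hg
  · intro v hv
    rw [← hGS]
    apply cuspAt_subst S T hST hTS
    rw [hD]
    apply cusp_C_mul hp
    apply cusp_at_infl h3 h2 hμ
    rw [hS, Matrix.smul_mulVec]
    apply inflLine_subst N M hMN _ _ _ (inv_ne_zero hc)
    rwa [hFN]

end Aux

theorem cuspidal_sextic_through_inflection_lines_is_dual
    (k : Type*) [Field k] (h2 : (2 : k) ≠ 0) (h3 : (3 : k) ≠ 0)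
    (F : MvPolynomial (Fin 3) k) (hF : IsSmoothCurve (bar F) 3)
    -- `G` is a plane sextic in `(ℙ²)∨`:
    (G : MvPolynomial (Fin 3) k) (hG6 : G.IsHomogeneous 6) (hG0 : G ≠ 0)
    -- reduced:
    (hred : Squarefree (bar G))
    -- singular at all the points of `T_C`:
    (hsing : ∀ w : Fin 3 → AlgebraicClosure k, IsInflLine (bar F) w → SingAt (bar G) w)
    -- with a cusp at (at least) one point of `T_C`:
    (hcusp : ∃ w : Fin 3 → AlgebraicClosure k, IsInflLine (bar F) w ∧ IsCuspAt (bar G) w) :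
    -- then `G` is the dual curve `C∨` of `C`, and in particular all its singular
    -- points (at the inflection lines) are cusps:
    Irreducible (bar G) ∧ ContainsGaussImage (bar G) (bar F) ∧
      ∀ w : Fin 3 → AlgebraicClosure k, IsInflLine (bar F) w → IsCuspAt (bar G) w := by
  have hi : Function.Injective (algebraMap k (AlgebraicClosure k)) :=
    (algebraMap k (AlgebraicClosure k)).injective
  have h2' : (2 : AlgebraicClosure k) ≠ 0 := by
    intro h
    apply h2
    apply hi
    rw [map_ofNat, map_zero]
    exact h
  have h3' : (3 : AlgebraicClosure k) ≠ 0 := by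
    intro h
    apply h3
    apply hi
    rw [map_ofNat, map_zero]
    exact h
  exact main_closed h2' h3' hF (hG6.map _) hred hsing hcusp

end Infl
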